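/- arXiv:1604.02303 — 2 statements merged into one kernel-verified Lean document; each statement's English description precedes it below -/
import Mathlib

section
/- The membership problem for 2×2 nonsingular integer matrices is decidable. Precisely, the predicate P on pairs (L, M), where L is a finite list of 2×2 integer matrices and M is a 2×2 integer matrix (matrices encoded as 4-tuples of integers so that the pairs form an encodable type), defined by P(L, M) := "every matrix occurring in L has nonzero determinant, and M belongs to the multiplicative monoid generated by the matrices in L (i.e., M is the identity matrix or a finite product of matrices from L)", is a computable predicate in the recursion-theoretic sense (ComputablePred). -/
/-- 2×2 integer matrices. -/
abbrev M2 := Matrix (Fin 2) (Fin 2) ℤ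

/-- Decoding of a 4-tuple of integers as a 2×2 integer matrix. -/
def tupToMat (p : ℤ × ℤ × ℤ × ℤ) : M2 := !![p.1, p.2.1; p.2.2.1, p.2.2.2]


namespace MP
open Encodable

abbrev T4 := ℤ × ℤ × ℤ × ℤ

theorem encode_int_ofNat (n : ℕ) : encode (n : ℤ) = 2 * n := by rfl
theorem encode_int_negSucc (n : ℕ) : encode (Int.negSucc n) = 2 * n + 1 := by rfl

theorem primrec_toNat : Primrec (fun i : ℤ => i.toNat) := by
  refine (Primrec.cond (Primrec.nat_bodd.comp Primrec.encode) (Primrec.const 0)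
    (Primrec.nat_div2.comp Primrec.encode)).of_eq fun i => ?_
  cases i with
  | ofNat n => 
    have := encode_int_ofNat n
    simp only [Int.ofNat_eq_natCast, this]
    simp [Nat.div2_val]
  | negSucc n => 
    rw [encode_int_negSucc]
    simp

theorem primrec_negToNat : Primrec (fun i : ℤ => (-i).toNat) := by
  refine (Primrec.cond (Primrec.nat_bodd.comp Primrec.encode) 
    (Primrec.succ.comp (Primrec.nat_div2.comp Primrec.encode)) (Primrec.const 0)).of_eq fun i => ?_
  cases i with
  | ofNat n => 
    have := encode_int_ofNat n
    simp only [Int.ofNat_eq_natCast, this]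
    simp
  | negSucc n => 
    rw [encode_int_negSucc]
    simp [Nat.div2_val]

theorem primrec_diff : Primrec₂ (fun a b : ℕ => (a : ℤ) - (b : ℤ)) := by
  refine Primrec.encode_iff.1 ?_
  refine (Primrec.ite (c := fun p : ℕ × ℕ => p.2 ≤ p.1) (Primrec.nat_le.comp Primrec.snd Primrec.fst)
    (Primrec.nat_mul.comp (Primrec.const 2) (Primrec.nat_sub.comp Primrec.fst Primrec.snd))
    (Primrec.succ.comp (Primrec.nat_mul.comp (Primrec.const 2) 
      (Primrec.nat_sub.comp (Primrec.nat_sub.comp Primrec.snd Primrec.fst) (Primrec.const 1))))).of_eq ?_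
  rintro ⟨a, b⟩
  simp only
  split_ifs with h
  · have : (a : ℤ) - b = ((a - b : ℕ) : ℤ) := by omega
    rw [this, encode_int_ofNat]
  · have : (a : ℤ) - b = Int.negSucc (b - a - 1) := by omega
    rw [this, encode_int_negSucc]

variable {α β σ : Type} [Primcodable α] [Primcodable β] [Primcodable σ]

theorem primrec_iadd {f g : α → ℤ} (hf : Primrec f) (hg : Primrec g) :
    Primrec (fun a => f a + g a) := by
  refine (primrec_diff.comp 
    (Primrec.nat_add.comp (primrec_toNat.comp hf) (primrec_toNat.comp hg)) 
    (Primrec.nat_add.comp (primrec_negToNat.comp hf) (primrec_negToNat.comp hg))).of_eq fun a => ?_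
  push_cast
  omega

theorem primrec_isub {f g : α → ℤ} (hf : Primrec f) (hg : Primrec g) :
    Primrec (fun a => f a - g a) := by
  refine (primrec_diff.comp 
    (Primrec.nat_add.comp (primrec_toNat.comp hf) (primrec_negToNat.comp hg)) 
    (Primrec.nat_add.comp (primrec_negToNat.comp hf) (primrec_toNat.comp hg))).of_eq fun a => ?_
  push_cast
  omega

theorem toNat_diff (i : ℤ) : (i.toNat : ℤ) - ((-i).toNat : ℤ) = i := by omega

theorem primrec_imul {f g : α → ℤ} (hf : Primrec f) (hg : Primrec g) :
    Primrec (fun a => f a * g a) := by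
  refine (primrec_diff.comp 
    (Primrec.nat_add.comp 
      (Primrec.nat_mul.comp (primrec_toNat.comp hf) (primrec_toNat.comp hg))
      (Primrec.nat_mul.comp (primrec_negToNat.comp hf) (primrec_negToNat.comp hg)))
    (Primrec.nat_add.comp 
      (Primrec.nat_mul.comp (primrec_toNat.comp hf) (primrec_negToNat.comp hg))
      (Primrec.nat_mul.comp (primrec_negToNat.comp hf) (primrec_toNat.comp hg)))).of_eq fun a => ?_
  have h1 := toNat_diff (f a)
  have h2 := toNat_diff (g a)
  push_cast
  conv_rhs => rw [← h1, ← h2]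
  ring

theorem primrec_natAbs : Primrec (fun i : ℤ => i.natAbs) := by
  refine (Primrec.nat_add.comp primrec_toNat primrec_negToNat).of_eq fun a => ?_
  omega

theorem primrec_ilt {f g : α → ℤ} (hf : Primrec f) (hg : Primrec g) :
    PrimrecPred (fun a => f a < g a) := by
  refine (Primrec.nat_lt.comp 
    (Primrec.nat_add.comp (primrec_toNat.comp hf) (primrec_negToNat.comp hg)) 
    (Primrec.nat_add.comp (primrec_negToNat.comp hf) (primrec_toNat.comp hg))).of_eq fun a => ?_
  omega

theorem pp_all {f : α → List β} (hf : Primrec f) {p : α × β → Prop} (hp : PrimrecPred p) :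
    PrimrecPred (fun a => ∀ b ∈ f a, p (a, b)) :=
  (PrimrecRel.forall_mem_list (R := fun b a => p (a, b)) (hp.primrecRel.swap)).comp hf Primrec.id

theorem pp_ex {f : α → List β} (hf : Primrec f) {p : α × β → Prop} (hp : PrimrecPred p) :
    PrimrecPred (fun a => ∃ b ∈ f a, p (a, b)) :=
  (PrimrecRel.exists_mem_list (R := fun b a => p (a, b)) (hp.primrecRel.swap)).comp hf Primrec.id

theorem pp_eq {f g : α → β} (hf : Primrec f) (hg : Primrec g) :
    PrimrecPred (fun a => f a = g a) := Primrec.eq.comp hf hg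

theorem pp_mem {f : α → β} {g : α → List β} (hf : Primrec f) (hg : Primrec g) :
    PrimrecPred (fun a => f a ∈ g a) := by
  refine (pp_ex hg (p := fun x => x.2 = f x.1) (pp_eq Primrec.snd (hf.comp Primrec.fst))).of_eq
    fun a => ?_
  simp

theorem pp_imp {p q : α → Prop} (hp : PrimrecPred p) (hq : PrimrecPred q) :
    PrimrecPred (fun a => p a → q a) :=
  (hp.not.or hq).of_eq fun a => by tauto

theorem re_exists {p : α × β → Prop} (hp : PrimrecPred p) : REPred (fun a => ∃ b, p (a, b)) := by
  classical
  have hd : Computable (fun x : α × ℕ => ((decode x.2 : Option β).map 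
      (fun b => decide (p (x.1, b)))).getD false) := by
    apply Primrec.to_comp
    refine Primrec.option_getD.comp (Primrec.option_map (Primrec.decode.comp Primrec.snd) ?_) 
      (Primrec.const false)
    exact hp.decide.comp (Primrec.pair (Primrec.fst.comp Primrec.fst) Primrec.snd)
  have hr : Partrec (fun a : α => Nat.rfind (fun n => (Part.some (((decode n : Option β).map 
      (fun b => decide (p (a, b)))).getD false)))) :=
    Partrec.rfind (Computable.partrec hd)
  refine (Partrec.dom_re hr).of_eq fun a => ?_
  refine Nat.rfind_dom.trans ?_
  constructor
  · rintro ⟨n, hn, -⟩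
    cases h : (decode n : Option β) with
    | none => simp [h] at hn
    | some b => exact ⟨b, by simpa [h] using hn⟩
  · rintro ⟨b, hb⟩
    exact ⟨encode b, by simp [hb], by simp⟩

def tmul (p q : T4) : T4 := 
  (p.1 * q.1 + p.2.1 * q.2.2.1, p.1 * q.2.1 + p.2.1 * q.2.2.2,
   p.2.2.1 * q.1 + p.2.2.2 * q.2.2.1, p.2.2.1 * q.2.1 + p.2.2.2 * q.2.2.2)

def tdet (p : T4) : ℤ := p.1 * p.2.2.2 - p.2.1 * p.2.2.1

def tone : T4 := (1, 0, 0, 1)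

theorem primrec_tmul {f g : α → T4} (hf : Primrec f) (hg : Primrec g) :
    Primrec (fun a => tmul (f a) (g a)) := by
  have f1 := Primrec.fst.comp hf
  have f2 := Primrec.fst.comp (Primrec.snd.comp hf)
  have f3 := Primrec.fst.comp (Primrec.snd.comp (Primrec.snd.comp hf))
  have f4 := Primrec.snd.comp (Primrec.snd.comp (Primrec.snd.comp hf))
  have g1 := Primrec.fst.comp hg
  have g2 := Primrec.fst.comp (Primrec.snd.comp hg)
  have g3 := Primrec.fst.comp (Primrec.snd.comp (Primrec.snd.comp hg))
  have g4 := Primrec.snd.comp (Primrec.snd.comp (Primrec.snd.comp hg))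
  exact Primrec.pair (primrec_iadd (primrec_imul f1 g1) (primrec_imul f2 g3))
    (Primrec.pair (primrec_iadd (primrec_imul f1 g2) (primrec_imul f2 g4))
    (Primrec.pair (primrec_iadd (primrec_imul f3 g1) (primrec_imul f4 g3))
    (primrec_iadd (primrec_imul f3 g2) (primrec_imul f4 g4))))

theorem primrec_tdet {f : α → T4} (hf : Primrec f) : Primrec (fun a => tdet (f a)) := by
  have f1 := Primrec.fst.comp hf
  have f2 := Primrec.fst.comp (Primrec.snd.comp hf)
  have f3 := Primrec.fst.comp (Primrec.snd.comp (Primrec.snd.comp hf))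
  have f4 := Primrec.snd.comp (Primrec.snd.comp (Primrec.snd.comp hf))
  exact primrec_isub (primrec_imul f1 f4) (primrec_imul f2 f3)

/-- Hermite normal form (upper triangular). -/
def THerm (p : T4) : Prop := 0 < p.1 ∧ p.2.2.1 = 0 ∧ -1 < p.2.1 ∧ p.2.1 < p.2.2.2

theorem pp_therm {f : α → T4} (hf : Primrec f) : PrimrecPred (fun a => THerm (f a)) := by
  have f1 := Primrec.fst.comp hf
  have f2 := Primrec.fst.comp (Primrec.snd.comp hf)
  have f3 := Primrec.fst.comp (Primrec.snd.comp (Primrec.snd.comp hf))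
  have f4 := Primrec.snd.comp (Primrec.snd.comp (Primrec.snd.comp hf))
  exact (primrec_ilt (Primrec.const 0) f1).and ((pp_eq f3 (Primrec.const 0)).and
    ((primrec_ilt (Primrec.const (-1)) f2).and (primrec_ilt f2 f4)))

/-- The signed permutation matrices. -/
def listA : List T4 := [(1,0,0,1), (-1,0,0,-1), (0,1,1,0), (0,-1,-1,0),
  (1,0,0,-1), (-1,0,0,1), (0,1,-1,0), (0,-1,1,0)]

/-- The automorphisms of the form x²+xy+y². -/
def listB : List T4 := [(1,0,0,1), (-1,0,0,-1), (0,1,1,0), (0,-1,-1,0),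
  (0,1,-1,-1), (0,-1,1,1), (-1,-1,1,0), (1,1,-1,0),
  (1,0,-1,-1), (-1,0,1,1), (-1,-1,0,1), (1,1,0,-1)]

abbrev NT := ℕ × T4

abbrev TT := T4 × T4 × T4

abbrev Cert := List (ℕ × T4) × List (T4 × T4 × T4)

abbrev Inp := (List T4 × T4) × Cert

def Check (L : List T4) (M : T4) (S : List (ℕ × T4)) (R : List (T4 × T4 × T4)) : Prop :=
  (∃ p ∈ L, tdet p = 0) ∨ tdet M = 0 ∨
  ((∃ s ∈ S, s.2 = M) ∧ (∃ s ∈ S, s.2 = tone) ∧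
   (∀ s ∈ S, THerm s.2 ∨ ∃ s' ∈ S, s'.1 < s.1 ∧ ∃ c ∈ listA ++ listB, s.2 = tmul c s'.2) ∧
   (∀ s ∈ S, THerm s.2 → ∀ X ∈ L, (tdet M).natAbs < (tdet (tmul s.2 X)).natAbs ∨ 
      ∃ s' ∈ S, s'.2 = tmul s.2 X) ∧
   (∀ s ∈ S, ∀ s' ∈ S, ∀ c ∈ listA ++ listB, s.2 = tmul c s'.2 → (s.2, c, s'.2) ∈ R) ∧
   (∀ s ∈ S, ∀ s' ∈ S, ∀ X ∈ L, s'.2 = tmul s.2 X → (s.2, tone, s'.2) ∈ R) ∧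
   (∀ r ∈ R, ∀ r' ∈ R, r.2.2 = r'.1 → 
     ((r.2.1 ∈ listA ∧ r'.2.1 ∈ listA) ∨ (r.2.1 ∈ listB ∧ r'.2.1 ∈ listB)) →
       (r.1, tmul r.2.1 r'.2.1, r'.2.2) ∈ R) ∧
   ¬ (tone, tone, M) ∈ R)

theorem pp_check : PrimrecPred (fun x : (List T4 × T4) × Cert => 
    Check x.1.1 x.1.2 x.2.1 x.2.2) := by
  have hL : Primrec (fun x : (List T4 × T4) × Cert => x.1.1) := Primrec.fst.comp Primrec.fst
  have hM : Primrec (fun x : (List T4 × T4) × Cert => x.1.2) := Primrec.snd.comp Primrec.fst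
  have hS : Primrec (fun x : (List T4 × T4) × Cert => x.2.1) := Primrec.fst.comp Primrec.snd
  have hR : Primrec (fun x : (List T4 × T4) × Cert => x.2.2) := Primrec.snd.comp Primrec.snd
  have F : ∀ {α β : Type} [Primcodable α] [Primcodable β], Primrec (Prod.fst : α × β → α) := 
    Primrec.fst
  have N : ∀ {α β : Type} [Primcodable α] [Primcodable β], Primrec (Prod.snd : α × β → β) := 
    Primrec.snd
  unfold Check
  refine PrimrecPred.or (pp_ex hL (p := fun x => tdet x.2 = 0) 
    (pp_eq (primrec_tdet N) (Primrec.const 0))) ?_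
  refine PrimrecPred.or (pp_eq (primrec_tdet hM) (Primrec.const 0)) ?_
  refine PrimrecPred.and (pp_ex hS (p := fun x => x.2.2 = x.1.1.2) 
    (pp_eq (N.comp N) (hM.comp F))) ?_
  refine PrimrecPred.and (pp_ex hS (p := fun x => x.2.2 = tone) 
    (pp_eq (N.comp N) (Primrec.const _))) ?_
  refine PrimrecPred.and (pp_all hS (p := fun x => THerm x.2.2 ∨ 
    ∃ s' ∈ x.1.2.1, s'.1 < x.2.1 ∧ ∃ c ∈ listA ++ listB, x.2.2 = tmul c s'.2) ?_) ?_
  · refine PrimrecPred.or (pp_therm (N.comp N)) ?_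
    refine pp_ex (hS.comp F) (p := fun y : (Inp × NT) × NT => y.2.1 < y.1.2.1 ∧ 
      ∃ c ∈ listA ++ listB, y.1.2.2 = tmul c y.2.2) ?_
    refine PrimrecPred.and (Primrec.nat_lt.comp (F.comp N) (F.comp (N.comp F))) ?_
    refine pp_ex (Primrec.const _) (p := fun z : ((Inp × NT) × NT) × T4 => z.1.1.2.2 = tmul z.2 z.1.2.2) ?_
    exact pp_eq (N.comp (N.comp (F.comp F))) (primrec_tmul N (N.comp (N.comp F)))
  refine PrimrecPred.and (pp_all hS (p := fun x => THerm x.2.2 → ∀ X ∈ x.1.1.1,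
    (tdet x.1.1.2).natAbs < (tdet (tmul x.2.2 X)).natAbs ∨ 
      ∃ s' ∈ x.1.2.1, s'.2 = tmul x.2.2 X) ?_) ?_
  · refine pp_imp (pp_therm (N.comp N)) ?_
    refine pp_all (hL.comp F) (p := fun y : (Inp × NT) × T4 => (tdet y.1.1.1.2).natAbs < 
      (tdet (tmul y.1.2.2 y.2)).natAbs ∨ ∃ s' ∈ y.1.1.2.1, s'.2 = tmul y.1.2.2 y.2) ?_
    refine PrimrecPred.or (Primrec.nat_lt.comp 
      (primrec_natAbs.comp (primrec_tdet (hM.comp (F.comp F))))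
      (primrec_natAbs.comp (primrec_tdet (primrec_tmul (N.comp (N.comp F)) N)))) ?_
    refine pp_ex (hS.comp (F.comp F)) (p := fun z : ((Inp × NT) × T4) × NT => z.2.2 = tmul z.1.1.2.2 z.1.2) ?_
    exact pp_eq (N.comp N) (primrec_tmul (N.comp (N.comp (F.comp F))) (N.comp F))
  refine PrimrecPred.and (pp_all hS (p := fun x => ∀ s' ∈ x.1.2.1, ∀ c ∈ listA ++ listB, 
    x.2.2 = tmul c s'.2 → (x.2.2, c, s'.2) ∈ x.1.2.2) ?_) ?_
  · refine pp_all (hS.comp F) (p := fun y : (Inp × NT) × NT => ∀ c ∈ listA ++ listB, 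
      y.1.2.2 = tmul c y.2.2 → (y.1.2.2, c, y.2.2) ∈ y.1.1.2.2) ?_
    refine pp_all (Primrec.const _) (p := fun z : ((Inp × NT) × NT) × T4 => 
      z.1.1.2.2 = tmul z.2 z.1.2.2 → (z.1.1.2.2, z.2, z.1.2.2) ∈ z.1.1.1.2.2) ?_
    refine pp_imp (pp_eq (N.comp (N.comp (F.comp F))) (primrec_tmul N (N.comp (N.comp F)))) ?_
    exact pp_mem (Primrec.pair (N.comp (N.comp (F.comp F))) (Primrec.pair N (N.comp (N.comp F))))
      (hR.comp (F.comp (F.comp F)))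
  refine PrimrecPred.and (pp_all hS (p := fun x => ∀ s' ∈ x.1.2.1, ∀ c ∈ x.1.1.1, 
    s'.2 = tmul x.2.2 c → (x.2.2, tone, s'.2) ∈ x.1.2.2) ?_) ?_
  · refine pp_all (hS.comp F) (p := fun y : (Inp × NT) × NT => ∀ c ∈ y.1.1.1.1, 
      y.2.2 = tmul y.1.2.2 c → (y.1.2.2, tone, y.2.2) ∈ y.1.1.2.2) ?_
    refine pp_all (hL.comp (F.comp F)) (p := fun z : ((Inp × NT) × NT) × T4 => 
      z.1.2.2 = tmul z.1.1.2.2 z.2 → (z.1.1.2.2, tone, z.1.2.2) ∈ z.1.1.1.2.2) ?_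
    refine pp_imp (pp_eq (N.comp (N.comp F)) (primrec_tmul (N.comp (N.comp (F.comp F))) N)) ?_
    exact pp_mem (Primrec.pair (N.comp (N.comp (F.comp F))) 
      (Primrec.pair (Primrec.const _) (N.comp (N.comp F))))
      (hR.comp (F.comp (F.comp F)))
  refine PrimrecPred.and (pp_all hR (p := fun x => ∀ r' ∈ x.1.2.2, x.2.2.2 = r'.1 → 
     ((x.2.2.1 ∈ listA ∧ r'.2.1 ∈ listA) ∨ (x.2.2.1 ∈ listB ∧ r'.2.1 ∈ listB)) →
       (x.2.1, tmul x.2.2.1 r'.2.1, r'.2.2) ∈ x.1.2.2) ?_) ?_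
  · refine pp_all (hR.comp F) (p := fun y : (Inp × TT) × TT => y.1.2.2.2 = y.2.1 → 
     ((y.1.2.2.1 ∈ listA ∧ y.2.2.1 ∈ listA) ∨ (y.1.2.2.1 ∈ listB ∧ y.2.2.1 ∈ listB)) →
       (y.1.2.1, tmul y.1.2.2.1 y.2.2.1, y.2.2.2) ∈ y.1.1.2.2) ?_
    have a1 : Primrec (fun y : (((List T4 × T4) × Cert) × T4 × T4 × T4) × T4 × T4 × T4 => 
      y.1.2.2.1) := F.comp (N.comp (N.comp F))
    have a2 : Primrec (fun y : (((List T4 × T4) × Cert) × T4 × T4 × T4) × T4 × T4 × T4 => 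
      y.2.2.1) := F.comp (N.comp N)
    refine pp_imp (pp_eq (N.comp (N.comp (N.comp F))) (F.comp N)) ?_
    refine pp_imp (PrimrecPred.or 
      (PrimrecPred.and (pp_mem a1 (Primrec.const _)) (pp_mem a2 (Primrec.const _)))
      (PrimrecPred.and (pp_mem a1 (Primrec.const _)) (pp_mem a2 (Primrec.const _)))) ?_
    exact pp_mem (Primrec.pair (F.comp (N.comp F)) (Primrec.pair (primrec_tmul a1 a2) 
      (N.comp (N.comp N)))) (hR.comp (F.comp F))
  exact (pp_mem (Primrec.pair (Primrec.const _) (Primrec.pair (Primrec.const _) hM)) hR).not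

/-- Positive certificates: a word over the generators with the right product. -/
def PosCheck (L : List T4) (M : T4) (w : List T4) : Prop :=
  (∀ p ∈ L, ¬ tdet p = 0) ∧ (∀ p ∈ w, p ∈ L) ∧ w.foldr tmul tone = M

theorem pp_posCheck : PrimrecPred (fun x : (List T4 × T4) × List T4 => 
    PosCheck x.1.1 x.1.2 x.2) := by
  have hL : Primrec (fun x : (List T4 × T4) × List T4 => x.1.1) := Primrec.fst.comp Primrec.fst
  have hM : Primrec (fun x : (List T4 × T4) × List T4 => x.1.2) := Primrec.snd.comp Primrec.fst
  refine PrimrecPred.and (pp_all hL (p := fun x => ¬ tdet x.2 = 0) 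
    (pp_eq (primrec_tdet Primrec.snd) (Primrec.const 0)).not) ?_
  refine PrimrecPred.and (pp_all Primrec.snd (p := fun x : ((List T4 × T4) × List T4) × T4 => x.2 ∈ x.1.1.1)
    (pp_mem Primrec.snd (hL.comp Primrec.fst))) ?_
  refine pp_eq ?_ hM
  exact Primrec.list_foldr Primrec.snd (Primrec.const tone) 
    (h := fun _ y => tmul y.1 y.2) (primrec_tmul (Primrec.fst.comp Primrec.snd) 
      (Primrec.snd.comp Primrec.snd))

end MP

namespace MP

section Abstract
variable {G St : Type} [Monoid G] (K : Bool → Submonoid G) (R : St → G → St → Prop) (s0 : St)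

/-- Nonempty alternating stacks; the Boolean records the group of the top letter. -/
inductive Str : Bool → G → St → Prop
  | start {k x s} : x ∈ K k → x ∉ K (!k) → R s0 x s → Str k x s
  | next {k g s' x s} : Str (!k) g s' → x ∈ K k → x ∉ K (!k) → R s' x s → Str k (g * x) s

def Config (g : G) (s : St) : Prop :=
  ((∀ k, g ∈ K k) ∧ R s0 g s) ∨ ∃ k, Str K R s0 k g s

variable {K R s0}

theorem Str.absorb (hR : ∀ k x y s s' s'', x ∈ K k → y ∈ K k → R s x s' → R s' y s'' → 
      R s (x * y) s'') {k : Bool} {g : G} {s s' : St} {y y' : G} (h : Str K R s0 k g s) 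
      (hy : ∀ k, y ∈ K k) (hy' : ∀ k, y' ∈ K k) (hyy : y * y' = 1)
      (hr : R s y s') : Str K R s0 k (g * y) s' := by
  have key : ∀ {x : G} {j : Bool}, x ∉ K j → x * y ∉ K j := by
    intro x j hx h
    apply hx
    have := (K j).mul_mem h (hy' j)
    rwa [mul_assoc, hyy, mul_one] at this
  cases h with
  | start h1 h2 h3 =>
    exact Str.start ((K k).mul_mem h1 (hy k)) (key h2) (hR k _ _ _ _ _ h1 (hy k) h3 hr)
  | next h0 h1 h2 h3 =>
    rw [mul_assoc]
    exact Str.next h0 ((K k).mul_mem h1 (hy k)) (key h2) (hR k _ _ _ _ _ h1 (hy k) h3 hr)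

theorem bool_all {k : Bool} {p : Bool → Prop} (h1 : p k) (h2 : p (!k)) : ∀ j, p j := by
  intro j
  cases j <;> cases k <;> simp_all

theorem Config.step (hR : ∀ k x y s s' s'', x ∈ K k → y ∈ K k → R s x s' → R s' y s'' → 
      R s (x * y) s'') (hinv : ∀ y, (∀ k, y ∈ K k) → ∃ y', (∀ k, y' ∈ K k) ∧ y * y' = 1)
      {g : G} {s s' : St} {k : Bool} {y : G}
      (h : Config K R s0 g s) (hy : y ∈ K k) (hr : R s y s') : Config K R s0 (g * y) s' := by
  rcases h with ⟨h1, h2⟩ | ⟨k', h⟩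
  · have hm := (K k).mul_mem (h1 k) hy
    have hr' := hR k _ _ _ _ _ (h1 k) hy h2 hr
    by_cases hc : g * y ∈ K (!k)
    · exact Or.inl ⟨bool_all hm hc, hr'⟩
    · exact Or.inr ⟨k, Str.start hm hc hr'⟩
  · by_cases hyc : y ∈ K (!k)
    · obtain ⟨y', h1, h2⟩ := hinv y (bool_all hy hyc)
      exact Or.inr ⟨k', h.absorb hR (bool_all hy hyc) h1 h2 hr⟩
    by_cases hk : k' = k
    · subst hk
      cases h with
      | start h1 h2 h3 =>
        have hm := (K k').mul_mem h1 hy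
        have hr' := hR k' _ _ _ _ _ h1 hy h3 hr
        by_cases hc : g * y ∈ K (!k')
        · exact Or.inl ⟨bool_all hm hc, hr'⟩
        · exact Or.inr ⟨k', Str.start hm hc hr'⟩
      | @next _ g0 s1 x _ h0 h1 h2 h3 =>
        have hm := (K k').mul_mem h1 hy
        have hr' := hR k' _ _ _ _ _ h1 hy h3 hr
        rw [mul_assoc]
        by_cases hc : x * y ∈ K (!k')
        · obtain ⟨y', h1', h2'⟩ := hinv (x * y) (bool_all hm hc)
          exact Or.inr ⟨_, h0.absorb hR (bool_all hm hc) h1' h2' hr'⟩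
        · exact Or.inr ⟨k', Str.next h0 hm hc hr'⟩
    · have : k' = !k := by cases k <;> cases k' <;> simp_all
      subst this
      exact Or.inr ⟨k, Str.next h hy hyc hr⟩

end Abstract

/-! ### Basic facts on tuples -/

theorem tm_mul (p q : T4) : tupToMat (tmul p q) = tupToMat p * tupToMat q := by
  simp [tupToMat, tmul]

theorem tm_one : tupToMat tone = 1 := by
  simp [tupToMat, tone, Matrix.one_fin_two]

theorem tm_det (p : T4) : (tupToMat p).det = tdet p := by
  simp [tupToMat, tdet, Matrix.det_fin_two]

theorem tm_inj {p q : T4} (h : tupToMat p = tupToMat q) : p = q := by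
  have h1 := congrFun (congrFun h 0) 0
  have h2 := congrFun (congrFun h 0) 1
  have h3 := congrFun (congrFun h 1) 0
  have h4 := congrFun (congrFun h 1) 1
  simp [tupToMat] at h1 h2 h3 h4
  exact Prod.ext h1 (Prod.ext h2 (Prod.ext h3 h4))

theorem tdet_mul (p q : T4) : tdet (tmul p q) = tdet p * tdet q := by
  rw [← tm_det, tm_mul, Matrix.det_mul, tm_det, tm_det]

theorem tmul_assoc (p q r : T4) : tmul (tmul p q) r = tmul p (tmul q r) := 
  tm_inj (by simp only [tm_mul, mul_assoc])

theorem tone_mul (p : T4) : tmul tone p = p := tm_inj (by rw [tm_mul, tm_one, one_mul])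

theorem tmul_one (p : T4) : tmul p tone = p := tm_inj (by rw [tm_mul, tm_one, mul_one])

def lst (k : Bool) : List T4 := cond k listA listB

theorem lst_mul : ∀ k, ∀ p ∈ lst k, ∀ q ∈ lst k, tmul p q ∈ lst k := by decide
theorem lst_one : ∀ k, tone ∈ lst k := by decide
theorem lst_inv : ∀ k, ∀ p ∈ lst k, ∃ q ∈ lst k, tmul p q = tone ∧ tmul q p = tone := by decide
theorem lst_inv2 : ∀ p ∈ lst true, p ∈ lst false → 
    ∃ q ∈ lst true, q ∈ lst false ∧ tmul p q = tone := by decide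

theorem mem_sig {c : T4} : c ∈ listA ++ listB ↔ ∃ k, c ∈ lst k := by
  simp [lst, or_comm]

def K (k : Bool) : Submonoid M2 where
  carrier := {m | ∃ p ∈ lst k, tupToMat p = m}
  mul_mem' := by
    rintro _ _ ⟨p, hp, rfl⟩ ⟨q, hq, rfl⟩
    exact ⟨_, lst_mul k p hp q hq, tm_mul p q⟩
  one_mem' := ⟨tone, lst_one k, tm_one⟩

theorem mem_K {k : Bool} {m : M2} : m ∈ K k ↔ ∃ p ∈ lst k, tupToMat p = m := Iff.rfl

theorem tm_mem_K {k : Bool} {p : T4} : tupToMat p ∈ K k ↔ p ∈ lst k := by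
  rw [mem_K]
  constructor
  · rintro ⟨q, hq, h⟩
    rwa [← tm_inj h]
  · intro h
    exact ⟨p, h, rfl⟩

theorem K_inv (y : M2) (hy : ∀ k, y ∈ K k) : ∃ y', (∀ k, y' ∈ K k) ∧ y * y' = 1 := by
  obtain ⟨p, hp, rfl⟩ := hy true
  obtain ⟨q, h1, h2, h3⟩ := lst_inv2 p hp (tm_mem_K.1 (hy false))
  refine ⟨tupToMat q, ?_, ?_⟩
  · intro k
    cases k
    · exact tm_mem_K.2 h2
    · exact tm_mem_K.2 h1
  · rw [← tm_mul, h3, tm_one]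

/-! ### Ping-pong -/

def TN (p : T4) : Prop := 0 ≤ p.1 ∧ 0 ≤ p.2.1 ∧ 0 ≤ p.2.2.1 ∧ 0 ≤ p.2.2.2 ∧
  3 ≤ p.1 + p.2.1 + p.2.2.1 + p.2.2.2

instance (p : T4) : Decidable (TN p) := by unfold TN; infer_instance

def PN (p : T4) : Prop := TN p ∨ TN (tmul (-1, 0, 0, -1) p)

instance (p : T4) : Decidable (PN p) := by unfold PN; infer_instance

def te : T4 := (1, 0, 0, -1)

theorem pn1 : ∀ a ∈ listA, a ∉ listB → ∀ b ∈ listB, b ∉ listA → PN (tmul a b) := by decide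

theorem pn2 : ∀ b ∈ listB, b ∉ listA → PN (tmul te b) := by decide

theorem pn3 (g b : T4) (hb : b ∈ listB) (hb' : b ∉ listA) (h : PN (tmul g te)) : 
    PN (tmul g b) := by
  have hb2 : b ∈ [(0,1,-1,-1), (0,-1,1,1), (-1,-1,1,0), (1,1,-1,0),
    (1,0,-1,-1), (-1,0,1,1), (-1,-1,0,1), (1,1,0,-1)] := by
    revert b
    decide
  obtain ⟨x, y, z, w⟩ := g
  simp only [PN, TN, tmul, te] at h ⊢
  simp only [List.mem_cons, List.not_mem_nil, or_false] at hb2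
  rcases hb2 with rfl | rfl | rfl | rfl | rfl | rfl | rfl | rfl <;> simp only <;> omega

theorem pn4 (g a : T4) (ha : a ∈ listA) (ha' : a ∉ listB) (h : PN g) : 
    PN (tmul (tmul g a) te) := by
  have ha2 : a ∈ [(1,0,0,-1), (-1,0,0,1), (0,1,-1,0), (0,-1,1,0)] := by
    revert a
    decide
  obtain ⟨x, y, z, w⟩ := g
  simp only [PN, TN, tmul, te] at h ⊢
  simp only [List.mem_cons, List.not_mem_nil, or_false] at ha2
  rcases ha2 with rfl | rfl | rfl | rfl <;> simp only <;> omega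

theorem str_ne_one {St : Type} {R : St → M2 → St → Prop} {s0 : St} {k : Bool} {g : M2} {s : St}
    (h : Str K R s0 k g s) : g ≠ 1 := by
  have key : ∃ p, tupToMat p = g ∧ cond k 
      ((p ∈ listA ∧ p ∉ listB) ∨ PN (tmul p te) ∨ PN (tmul (tmul te p) te)) 
      (PN p ∨ PN (tmul te p)) := by
    induction h with
    | @start k x s h1 h2 h3 =>
      obtain ⟨p, hp, rfl⟩ := h1
      rw [tm_mem_K] at h2
      refine ⟨p, rfl, ?_⟩
      cases k
      · exact Or.inr (pn2 p hp h2)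
      · exact Or.inl ⟨hp, h2⟩
    | @next k g s' x s h0 h1 h2 h3 ih =>
      obtain ⟨q, rfl, hq⟩ := ih
      obtain ⟨p, hp, rfl⟩ := h1
      rw [tm_mem_K] at h2
      refine ⟨tmul q p, tm_mul q p, ?_⟩
      cases k
      · rcases hq with ⟨h4, h5⟩ | h4 | h4
        · exact Or.inl (pn1 q h4 h5 p hp h2)
        · exact Or.inl (pn3 q p hp h2 h4)
        · right
          rw [← tmul_assoc]
          exact pn3 _ p hp h2 h4
      · rcases hq with h4 | h4
        · exact Or.inr (Or.inl (pn4 q p hp h2 h4))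
        · right; right
          rw [← tmul_assoc te]
          exact pn4 _ p hp h2 h4
  obtain ⟨p, rfl, hp⟩ := key
  intro h1
  rw [← tm_one] at h1
  rw [tm_inj h1] at hp
  revert hp
  cases k <;> simp only [cond_true, cond_false] <;> decide

/-! ### Hermite forms -/

theorem herm_unique {v H H' : T4} (hv : tdet v = 1 ∨ tdet v = -1) (h1 : THerm H) (h2 : THerm H') 
    (h : tmul v H = H') : v = tone := by
  obtain ⟨p, q, r, s⟩ := v
  obtain ⟨a, b, c, d⟩ := H
  obtain ⟨a', b', c', d'⟩ := H'
  simp only [THerm, tmul, tdet, tone, Prod.mk.injEq] at *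
  obtain ⟨ha, rfl, hb, hd⟩ := h1
  obtain ⟨ha', rfl, hb', hd'⟩ := h2
  obtain ⟨e1, e2, e3, e4⟩ := h
  have hr : r = 0 := by
    have : r * a = 0 := by linarith
    rcases mul_eq_zero.1 this with h | h
    · exact h
    · omega
  subst hr
  have hp : 0 < p := by
    have : 0 < p * a := by linarith
    exact pos_of_mul_pos_left this ha.le
  have hs : 0 < s := by
    have : 0 < s * d := by linarith
    exact pos_of_mul_pos_left this (by omega)
  have hps : p * s = 1 := by
    have := mul_pos hp hs
    rcases hv with h | h <;> linarith
  have hp1 : p = 1 := by nlinarith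
  subst hp1
  have hs1 : s = 1 := by linarith
  subst hs1
  refine ⟨rfl, ?_, rfl, rfl⟩
  have h1 : q < 1 := by
    by_contra hq
    nlinarith
  have h2 : -1 < q := by
    by_contra hq
    nlinarith
  omega

/-- `Red p`: p can be brought into Hermite form by letters. -/
inductive Red : T4 → Prop
  | herm {p} : THerm p → Red p
  | step {p c} : c ∈ listA ++ listB → Red p → Red (tmul c p)

theorem Red.of_mul {c p : T4} (hc : c ∈ listA ++ listB) (h : Red (tmul c p)) : Red p := by
  obtain ⟨k, hk⟩ := mem_sig.1 hc
  obtain ⟨q, hq, h1, h2⟩ := lst_inv k c hk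
  have := Red.step (mem_sig.2 ⟨k, hq⟩) h
  rwa [← tmul_assoc, h2, tone_mul] at this

theorem red_up {a b c d : ℤ} (h : Red (a + c, b + d, c, d)) : Red (a, b, c, d) := by
  refine Red.of_mul (c := (1, 1, 0, -1)) (by decide) ?_
  refine Red.of_mul (c := (1, 0, 0, -1)) (by decide) ?_
  convert h using 1
  simp [tmul]

theorem red_down {a b c d : ℤ} (h : Red (a - c, b - d, c, d)) : Red (a, b, c, d) := by
  refine Red.of_mul (c := (1, 0, 0, -1)) (by decide) ?_
  refine Red.of_mul (c := (1, 1, 0, -1)) (by decide) ?_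
  convert h using 1
  simp [tmul]
  constructor <;> ring

theorem red_upn (n : ℕ) : ∀ {a b c d : ℤ}, Red (a + n * c, b + n * d, c, d) → Red (a, b, c, d) := by
  induction n with
  | zero => intro a b c d h; simpa using h
  | succ n ih =>
    intro a b c d h
    apply ih
    apply red_up
    convert h using 2
    · push_cast; ring
    · congr 1; push_cast; ring

theorem red_downn (n : ℕ) : ∀ {a b c d : ℤ}, Red (a - n * c, b - n * d, c, d) → 
    Red (a, b, c, d) := by
  induction n with
  | zero => intro a b c d h; simpa using h
  | succ n ih =>
    intro a b c d h
    apply ih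
    apply red_down
    convert h using 2
    · push_cast; ring
    · congr 1; push_cast; ring

theorem red_sub (k : ℤ) {a b c d : ℤ} (h : Red (a - k * c, b - k * d, c, d)) : 
    Red (a, b, c, d) := by
  rcases Int.eq_nat_or_neg k with ⟨n, rfl | rfl⟩
  · exact red_downn n h
  · apply red_upn n
    simpa using h

theorem red_tri1 {a b d : ℤ} (ha : 0 < a) (hd : 0 < d) : Red (a, b, 0, d) := by
  apply red_sub (b / d)
  apply Red.herm
  have h1 := Int.emod_nonneg b hd.ne'
  have h2 := Int.emod_lt_of_pos b hd
  have h3 := Int.emod_add_mul_ediv b d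
  have h4 : b - b / d * d = b % d := by linarith
  rw [h4]
  refine ⟨?_, rfl, ?_, ?_⟩ <;> simp only <;> omega

theorem red_tri2 {a b d : ℤ} (ha : 0 < a) (hd : d ≠ 0) : Red (a, b, 0, d) := by
  rcases lt_or_gt_of_ne hd with h | h
  · refine Red.of_mul (c := (1, 0, 0, -1)) (by decide) ?_
    convert red_tri1 (b := b) ha (neg_pos.2 h) using 1
    simp [tmul]
  · exact red_tri1 ha h

theorem red_tri {a b d : ℤ} (ha : a ≠ 0) (hd : d ≠ 0) : Red (a, b, 0, d) := by
  rcases lt_or_gt_of_ne ha with h | h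
  · refine Red.of_mul (c := (-1, 0, 0, 1)) (by decide) ?_
    convert red_tri2 (b := -b) (neg_pos.2 h) hd using 1
    simp [tmul]
  · exact red_tri2 h hd

theorem red_all_aux (n : ℕ) : ∀ a b c d : ℤ, c.natAbs = n → a * d - b * c ≠ 0 → 
    Red (a, b, c, d) := by
  induction n using Nat.strong_induction_on with
  | _ n ih =>
    intro a b c d hn hdet
    by_cases hc : c = 0
    · subst hc
      have h : a * d ≠ 0 := by simpa using hdet
      exact red_tri (left_ne_zero_of_mul h) (right_ne_zero_of_mul h)
    · apply red_sub (a / c)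
      refine Red.of_mul (c := (0, 1, 1, 0)) (by decide) ?_
      have h3 := Int.emod_add_mul_ediv a c
      have h4 : a - a / c * c = a % c := by linarith
      have h5 := Int.emod_nonneg a hc
      have h6 := Int.emod_lt_abs a hc
      rw [Int.abs_eq_natAbs] at h6
      have := ih (a % c).natAbs (by omega) c d (a % c) (b - a / c * d) rfl (by
        rw [← h4]
        intro h
        apply hdet
        linarith)
      convert this using 1
      simp [tmul, h4]

theorem red_all (p : T4) (hp : tdet p ≠ 0) : Red p := red_all_aux _ _ _ _ _ rfl hp

theorem red_list {p : T4} (h : Red p) : ∃ l : List NT, (∃ s ∈ l, s.2 = p) ∧ 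
    ∀ s ∈ l, THerm s.2 ∨ ∃ s' ∈ l, s'.1 < s.1 ∧ ∃ c ∈ listA ++ listB, s.2 = tmul c s'.2 := by
  induction h with
  | @herm p h => exact ⟨[(0, p)], by simp, by simp [h]⟩
  | @step p c hc _ ih =>
    obtain ⟨l, ⟨s, hs, rfl⟩, hl⟩ := ih
    refine ⟨(s.1 + 1, tmul c s.2) :: l, ⟨_, List.mem_cons_self, rfl⟩, ?_⟩
    intro t ht
    rcases List.mem_cons.1 ht with rfl | ht
    · exact Or.inr ⟨s, List.mem_cons_of_mem _ hs, Nat.lt_succ_self _, c, hc, rfl⟩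
    · rcases hl t ht with h | ⟨s', h1, h2⟩
      · exact Or.inl h
      · exact Or.inr ⟨s', List.mem_cons_of_mem _ h1, h2⟩

/-! ### Words -/

def tprod (w : List T4) : T4 := w.foldr tmul tone

theorem mem_closure_iff (L : List T4) (M : T4) : 
    tupToMat M ∈ Submonoid.closure {A : M2 | ∃ p ∈ L, tupToMat p = A} ↔ 
    ∃ w : List T4, (∀ p ∈ w, p ∈ L) ∧ tprod w = M := by
  constructor
  · intro h
    have : ∀ A ∈ Submonoid.closure {A : M2 | ∃ p ∈ L, tupToMat p = A}, 
        ∃ w : List T4, (∀ p ∈ w, p ∈ L) ∧ tupToMat (tprod w) = A := by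
      intro A hA
      obtain ⟨l, hl, rfl⟩ := Submonoid.exists_list_of_mem_closure hA
      clear hA
      induction l with
      | nil => exact ⟨[], by simp, by simp [tprod, tm_one]⟩
      | cons x l ih =>
        obtain ⟨w, hw, hw'⟩ := ih (fun y hy => hl y (List.mem_cons_of_mem _ hy))
        obtain ⟨p, hp, rfl⟩ := hl x List.mem_cons_self
        refine ⟨p :: w, ?_, ?_⟩
        · intro q hq
          rcases List.mem_cons.1 hq with rfl | hq
          · exact hp
          · exact hw q hq
        · rw [List.prod_cons, ← hw', ← tm_mul]; rfl
    obtain ⟨w, hw, hw'⟩ := this _ h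
    exact ⟨w, hw, tm_inj hw'⟩
  · rintro ⟨w, hw, rfl⟩
    induction w with
    | nil => 
      have : tupToMat (tprod []) = 1 := tm_one
      rw [this]; exact Submonoid.one_mem _
    | cons x w ih =>
      have : tupToMat (tprod (x :: w)) = tupToMat x * tupToMat (tprod w) := tm_mul _ _
      rw [this]
      refine Submonoid.mul_mem _ (Submonoid.subset_closure ⟨x, hw x List.mem_cons_self, rfl⟩) 
        (ih fun p hp => hw p (List.mem_cons_of_mem _ hp))

theorem tprod_append (w v : List T4) : tprod (w ++ v) = tmul (tprod w) (tprod v) := by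
  induction w with
  | nil => exact (tone_mul _).symm
  | cons x w ih =>
    change tmul x (tprod (w ++ v)) = tmul (tmul x (tprod w)) (tprod v)
    rw [ih, tmul_assoc]

theorem tprod_det_ne {L : List T4} (hL : ∀ p ∈ L, tdet p ≠ 0) (w : List T4) 
    (hw : ∀ p ∈ w, p ∈ L) : tdet (tprod w) ≠ 0 := by
  induction w with
  | nil => decide
  | cons x w ih =>
    change tdet (tmul x (tprod w)) ≠ 0
    rw [tdet_mul]
    exact mul_ne_zero (hL x (hw x List.mem_cons_self)) (ih fun p hp => hw p (List.mem_cons_of_mem _ hp))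

theorem herm_det {p : T4} (h : THerm p) : tdet p ≠ 0 := by
  obtain ⟨a, b, c, d⟩ := p
  obtain ⟨h1, h2, h3, h4⟩ := h
  simp only at *
  subst h2
  simp only [tdet, mul_zero, sub_zero]
  exact (mul_pos h1 (by omega)).ne'

theorem sig_det : ∀ c ∈ listA ++ listB, tdet c = 1 ∨ tdet c = -1 := by decide

end MP

namespace MP

theorem unit_of_sig {c : T4} (hc : c ∈ listA ++ listB) : IsUnit (tupToMat c) := by
  rw [Matrix.isUnit_iff_isUnit_det, tm_det, Int.isUnit_iff]
  exact sig_det c hc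

theorem exists_tup (m : M2) : ∃ p, tupToMat p = m :=
  ⟨(m 0 0, m 0 1, m 1 0, m 1 1), by
    ext i j
    fin_cases i <;> fin_cases j <;> rfl⟩

theorem herm_unique_mat {g u : M2} {H H' : T4} (hg : IsUnit g) (hu : IsUnit u) (h1 : THerm H)
    (h2 : THerm H') (h : g * tupToMat H = u * tupToMat H') : H = H' ∧ g = u := by
  obtain ⟨g, rfl⟩ := hg
  obtain ⟨u, rfl⟩ := hu
  obtain ⟨v, hv⟩ := exists_tup ((u⁻¹ * g : M2ˣ) : M2)
  have e : tmul v H = H' := by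
    apply tm_inj
    rw [tm_mul, hv, Units.val_mul, mul_assoc, h, ← mul_assoc, Units.inv_mul, one_mul]
  have hd : tdet v = 1 ∨ tdet v = -1 := by
    rw [← Int.isUnit_iff, ← tm_det, ← Matrix.isUnit_iff_isUnit_det, hv]
    exact Units.isUnit _
  have hv1 := herm_unique hd h1 h2 e
  subst hv1
  rw [tone_mul] at e
  refine ⟨e, ?_⟩
  rw [tm_one] at hv
  have : u⁻¹ * g = 1 := Units.ext hv.symm
  rw [inv_mul_eq_one] at this
  rw [this]

theorem check_sound {L : List T4} {M : T4} {S : List NT} {R : List TT} (hC : Check L M S R)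
    (hL : ∀ p ∈ L, tdet p ≠ 0) (w : List T4) (hw : ∀ p ∈ w, p ∈ L) : tprod w ≠ M := by
  intro hM
  have hMdet : tdet M ≠ 0 := hM ▸ tprod_det_ne hL w hw
  rcases hC with ⟨p, hp, hp'⟩ | h | hC
  · exact hL p hp hp'
  · exact hMdet h
  obtain ⟨⟨sM, hsM, rfl⟩, ⟨sI, hsI, hsI'⟩, hred, hext, hbase, hT, hcomp, hnot⟩ := hC
  let Rel : T4 → M2 → T4 → Prop := fun s x s' => ∃ c, tupToMat c = x ∧ (s, c, s') ∈ R
  have hR : ∀ k x y s s' s'', x ∈ K k → y ∈ K k → Rel s x s' → Rel s' y s'' → 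
      Rel s (x * y) s'' := by
    rintro k _ _ s s' s'' hx hy ⟨c, rfl, hc⟩ ⟨d, rfl, hd⟩
    rw [tm_mem_K] at hx hy
    refine ⟨tmul c d, tm_mul c d, ?_⟩
    refine hcomp _ hc _ hd rfl ?_
    cases k
    · exact Or.inr ⟨hx, hy⟩
    · exact Or.inl ⟨hx, hy⟩
  let Cf := Config K Rel tone
  have hstep : ∀ {g : M2} {s s' : T4} {k : Bool} {y : M2}, Cf g s → y ∈ K k → Rel s y s' → 
      Cf (g * y) s' := fun h hy hr => Config.step hR K_inv h hy hr
  -- base moves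
  have hmove : ∀ s ∈ S, ∀ s' ∈ S, ∀ c ∈ listA ++ listB, s.2 = tmul c s'.2 → ∀ g, Cf g s.2 → 
      Cf (g * tupToMat c) s'.2 := by
    intro s hs s' hs' c hc h g hg
    obtain ⟨k, hk⟩ := mem_sig.1 hc
    exact hstep hg (tm_mem_K.2 hk) ⟨c, rfl, hbase s hs s' hs' c hc h⟩
  -- reduction
  have hreduce : ∀ n, ∀ s ∈ S, s.1 = n → ∃ t ∈ S, THerm t.2 ∧ ∃ u : M2, IsUnit u ∧ 
      tupToMat s.2 = u * tupToMat t.2 ∧ (∀ g, Cf g s.2 → Cf (g * u) t.2) ∧ 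
      (∀ g, Cf (g * u) t.2 → Cf g s.2) := by
    intro n
    induction n using Nat.strong_induction_on with
    | _ n ih =>
      intro s hs hn
      rcases hred s hs with h | ⟨s', hs', hlt, c, hc, h⟩
      · exact ⟨s, hs, h, 1, isUnit_one, by simp, by simp, by simp⟩
      · obtain ⟨t, ht, hth, u, hu, h1, h2, h3⟩ := ih s'.1 (hn ▸ hlt) s' hs' rfl
        refine ⟨t, ht, hth, tupToMat c * u, (unit_of_sig hc).mul hu, ?_, ?_, ?_⟩
        · rw [h, tm_mul, h1, mul_assoc]
        · intro g hg
          rw [← mul_assoc]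
          exact h2 _ (hmove s hs s' hs' c hc h g hg)
        · intro g hg
          rw [← mul_assoc] at hg
          have h4 := h3 _ hg
          obtain ⟨k, hk⟩ := mem_sig.1 hc
          obtain ⟨c', hc', e1, e2⟩ := lst_inv k c hk
          have h5 := hmove s' hs' s hs c' (mem_sig.2 ⟨k, hc'⟩) 
            (by rw [h, ← tmul_assoc, e2, tone_mul]) _ h4
          rwa [mul_assoc, ← tm_mul, e1, tm_one, mul_one] at h5
  -- main induction
  have hmain : ∀ w : List T4, (∀ p ∈ w, p ∈ L) → ∀ t ∈ S, THerm t.2 → ∀ g : M2, IsUnit g → 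
      Cf g t.2 → (tdet (tmul t.2 (tprod w))).natAbs ≤ (tdet sM.2).natAbs → 
      ∃ t' ∈ S, THerm t'.2 ∧ ∃ g', IsUnit g' ∧ Cf g' t'.2 ∧ 
        g' * tupToMat t'.2 = g * tupToMat t.2 * tupToMat (tprod w) := by
    intro w
    induction w with
    | nil =>
      intro _ t ht hth g hg hc _
      refine ⟨t, ht, hth, g, hg, hc, ?_⟩
      have : tupToMat (tprod []) = 1 := tm_one
      rw [this, mul_one]
    | cons X w ih =>
      intro hw t ht hth g hg hc hd
      have hw' : ∀ p ∈ w, p ∈ L := fun p hp => hw p (List.mem_cons_of_mem _ hp)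
      have hX := hw X List.mem_cons_self
      have e : tprod (X :: w) = tmul X (tprod w) := rfl
      rw [e, ← tmul_assoc] at hd
      have hpos : 0 < (tdet (tprod w)).natAbs := Int.natAbs_pos.2 (tprod_det_ne hL w hw')
      have hle : (tdet (tmul t.2 X)).natAbs ≤ (tdet sM.2).natAbs := by
        refine le_trans ?_ hd
        rw [tdet_mul _ (tprod w), Int.natAbs_mul]
        exact Nat.le_mul_of_pos_right _ hpos
      rcases hext t ht hth X hX with h | ⟨s, hs, hsX⟩
      · omega
      have hc1 : Cf g s.2 := by
        have := hstep hc ((K true).one_mem) ⟨tone, tm_one, hT t ht s hs X hX hsX⟩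
        rwa [mul_one] at this
      obtain ⟨t', ht', hth', u, hu, h1, h2, h3⟩ := hreduce _ s hs rfl
      have hfin := ih hw' t' ht' hth' (g * u) (hg.mul hu) (h2 g hc1) (by
        rw [← hsX] at hd
        refine le_of_eq_of_le ?_ hd
        have hdu : (u.det).natAbs = 1 := by
          rw [Matrix.isUnit_iff_isUnit_det] at hu
          exact Int.isUnit_iff_natAbs_eq.1 hu
        rw [tdet_mul, tdet_mul, ← tm_det s.2, h1, Matrix.det_mul, tm_det, Int.natAbs_mul,
          Int.natAbs_mul, Int.natAbs_mul, hdu, one_mul])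
      obtain ⟨t2, ht2, hth2, g2, hg2, hc2, h4⟩ := hfin
      refine ⟨t2, ht2, hth2, g2, hg2, hc2, ?_⟩
      rw [h4, e, tm_mul, mul_assoc g u, ← h1, hsX, tm_mul]
      simp only [mul_assoc]
  have hI : Cf 1 sI.2 := by
    refine Or.inl ⟨fun k => (K k).one_mem, tone, tm_one, ?_⟩
    have := hbase sI hsI sI hsI tone (by decide) (tone_mul _).symm
    rwa [hsI'] at this ⊢
  obtain ⟨t, ht, hth, g, hg, hc, h1⟩ := hmain w hw sI hsI (by rw [hsI']; simp [THerm, tone]) 1 isUnit_one hI 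
    (by rw [hsI', tone_mul, hM])
  obtain ⟨t', ht', hth', u, hu, h2, -, h3⟩ := hreduce _ sM hsM rfl
  rw [hsI', tm_one, hM, one_mul, one_mul, h2] at h1
  obtain ⟨e1, e2⟩ := herm_unique_mat hg hu hth hth' h1
  subst e2
  rw [e1] at hc
  have hfinal : Cf 1 sM.2 := h3 1 (by rwa [one_mul])
  rcases hfinal with ⟨-, c, hc, hcR⟩ | ⟨k, hk⟩
  · rw [← tm_one] at hc
    rw [tm_inj hc] at hcR
    exact hnot hcR
  · exact str_ne_one hk rfl

theorem check_complete {L : List T4} {M : T4} (h : ¬ ∃ w : List T4, (∀ p ∈ w, p ∈ L) ∧ tprod w = M) :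
    ∃ S R, Check L M S R := by
  classical
  by_cases hL : ∃ p ∈ L, tdet p = 0
  · exact ⟨[], [], Or.inl hL⟩
  by_cases hM : tdet M = 0
  · exact ⟨[], [], Or.inr (Or.inl hM)⟩
  push Not at hL
  -- Hermite forms with bounded determinant
  let D : ℤ := (tdet M).natAbs
  have hfin : {H : T4 | THerm H ∧ (tdet H).natAbs ≤ (tdet M).natAbs}.Finite := by
    refine Set.Finite.subset ((Set.finite_Icc (0 : ℤ) D).prod ((Set.finite_Icc (0 : ℤ) D).prod 
      ((Set.finite_Icc (0 : ℤ) D).prod (Set.finite_Icc (0 : ℤ) D)))) ?_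
    rintro ⟨a, b, c, d⟩ ⟨⟨h1, h2, h3, h4⟩, h5⟩
    simp only at h1 h2 h3 h4
    subst h2
    have h5' : tdet (a, b, 0, d) = a * d := by simp [tdet]
    simp only [h5'] at h5
    have h6 : a * d ≤ D := by omega
    have h7 : a ≤ a * d := by nlinarith
    have h8 : d ≤ a * d := by nlinarith
    simp only [Set.mem_prod, Set.mem_Icc]
    omega
  let F : List T4 := M :: tone :: hfin.toFinset.toList.flatMap (fun H => L.map (fun X => tmul H X))
  have hF : ∀ p ∈ F, tdet p ≠ 0 := by
    intro p hp
    simp only [F, List.mem_cons, List.mem_flatMap, List.mem_map, Finset.mem_toList, 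
      Set.Finite.mem_toFinset] at hp
    rcases hp with rfl | rfl | ⟨H, hH, X, hX, rfl⟩
    · exact hM
    · decide
    · rw [tdet_mul]
      exact mul_ne_zero (herm_det hH.1) (hL X hX)
  have hl : ∀ p : T4, ∃ l : List NT, p ∈ F → (∃ s ∈ l, s.2 = p) ∧ 
    ∀ s ∈ l, THerm s.2 ∨ ∃ s' ∈ l, s'.1 < s.1 ∧ ∃ c ∈ listA ++ listB, s.2 = tmul c s'.2 := by
    intro p
    by_cases hp : p ∈ F
    · obtain ⟨l, hl⟩ := red_list (red_all p (hF p hp))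
      exact ⟨l, fun _ => hl⟩
    · exact ⟨[], fun h => absurd h hp⟩
  choose l hl using hl
  let S : List NT := F.flatMap l
  have hFS : ∀ p ∈ F, ∃ s ∈ S, s.2 = p := by
    intro p hp
    obtain ⟨s, hs, h⟩ := (hl p hp).1
    exact ⟨s, List.mem_flatMap.2 ⟨p, hp, hs⟩, h⟩
  let P : TT → Prop := fun r => ∃ w : List T4, (∀ p ∈ w, p ∈ L) ∧ 
    tmul r.2.1 r.2.2 = tmul r.1 (tprod w)
  let R : List TT := (S.flatMap fun s => S.flatMap fun s' => 
    (listA ++ listB).map fun c => (s.2, c, s'.2)).filter (fun r => P r)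
  have hRmem : ∀ r : TT, r ∈ R ↔ (∃ s ∈ S, s.2 = r.1) ∧ (∃ s' ∈ S, s'.2 = r.2.2) ∧ 
      r.2.1 ∈ listA ++ listB ∧ P r := by
    rintro ⟨x, c, y⟩
    simp only [R, List.mem_filter, List.mem_flatMap, List.mem_map, decide_eq_true_eq, 
      Prod.mk.injEq]
    constructor
    · rintro ⟨⟨s, hs, s', hs', c, hc, rfl, rfl, rfl⟩, h⟩
      exact ⟨⟨s, hs, rfl⟩, ⟨s', hs', rfl⟩, hc, h⟩
    · rintro ⟨⟨s, hs, rfl⟩, ⟨s', hs', rfl⟩, hc, h⟩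
      exact ⟨⟨s, hs, s', hs', c, hc, rfl, rfl, rfl⟩, h⟩
  refine ⟨S, R, Or.inr (Or.inr ⟨hFS M (by simp [F]), hFS tone (by simp [F]), ?_, ?_, ?_, ?_, ?_, ?_⟩)⟩
  · intro s hs
    obtain ⟨p, hp, hs⟩ := List.mem_flatMap.1 hs
    rcases (hl p hp).2 s hs with h | ⟨s', hs', h⟩
    · exact Or.inl h
    · exact Or.inr ⟨s', List.mem_flatMap.2 ⟨p, hp, hs'⟩, h⟩
  · intro s hs hsh X hX
    by_cases hd : (tdet M).natAbs < (tdet (tmul s.2 X)).natAbs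
    · exact Or.inl hd
    right
    apply hFS
    simp only [F, List.mem_cons, List.mem_flatMap, List.mem_map, Finset.mem_toList, 
      Set.Finite.mem_toFinset]
    refine Or.inr (Or.inr ⟨s.2, ⟨hsh, ?_⟩, X, hX, rfl⟩)
    refine le_trans ?_ (not_lt.1 hd)
    rw [tdet_mul, Int.natAbs_mul]
    exact Nat.le_mul_of_pos_right _ (Int.natAbs_pos.2 (hL X hX))
  · intro s hs s' hs' c hc h
    refine (hRmem _).2 ⟨⟨s, hs, rfl⟩, ⟨s', hs', rfl⟩, hc, [], by simp, ?_⟩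
    exact h.symm.trans (tmul_one _).symm
  · intro s hs s' hs' X hX h
    refine (hRmem _).2 ⟨⟨s, hs, rfl⟩, ⟨s', hs', rfl⟩, mem_sig.2 ⟨true, lst_one true⟩, [X], by simpa using hX, ?_⟩
    change tmul tone s'.2 = tmul s.2 (tmul X tone)
    rw [tone_mul, tmul_one, h]
  · rintro ⟨x, c, y⟩ hr ⟨y', c', z⟩ hr' h hcc
    obtain ⟨h1, -, -, w, hw, e⟩ := (hRmem _).1 hr
    obtain ⟨-, h2, -, w', hw', e'⟩ := (hRmem _).1 hr'
    simp only at h e e' hcc h1 h2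
    subst h
    refine (hRmem _).2 ⟨h1, h2, ?_, w ++ w', ?_, ?_⟩
    · rcases hcc with ⟨h3, h4⟩ | ⟨h3, h4⟩
      · exact mem_sig.2 ⟨true, lst_mul true _ h3 _ h4⟩
      · exact mem_sig.2 ⟨false, lst_mul false _ h3 _ h4⟩
    · intro p hp
      rcases List.mem_append.1 hp with hp | hp
      · exact hw p hp
      · exact hw' p hp
    · simp only
      rw [tmul_assoc, e', ← tmul_assoc, e, tprod_append, tmul_assoc]
  · intro hr
    obtain ⟨-, -, -, w, hw, e⟩ := (hRmem _).1 hr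
    simp only [tone_mul] at e
    exact h ⟨w, hw, e.symm⟩

end MP

/-- The membership problem for 2×2 nonsingular integer matrices is decidable. -/
theorem membership_problem_decidable :
    ComputablePred (fun q : List (ℤ × ℤ × ℤ × ℤ) × (ℤ × ℤ × ℤ × ℤ) =>
      (∀ p ∈ q.1, (tupToMat p).det ≠ 0) ∧
      tupToMat q.2 ∈ Submonoid.closure {A : M2 | ∃ p ∈ q.1, tupToMat p = A}) := by
  rw [ComputablePred.computable_iff_re_compl_re']
  constructor
  · refine (MP.re_exists MP.pp_posCheck).of_eq ?_
    rintro ⟨L, M⟩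
    simp only [MP.mem_closure_iff, MP.tm_det]
    constructor
    · rintro ⟨w, h1, h2, h3⟩
      exact ⟨h1, w, h2, h3⟩
    · rintro ⟨h1, w, h2, h3⟩
      exact ⟨w, h1, h2, h3⟩
  · refine (MP.re_exists MP.pp_check).of_eq ?_
    rintro ⟨L, M⟩
    simp only [MP.mem_closure_iff, MP.tm_det]
    constructor
    · rintro ⟨⟨S, R⟩, h⟩ ⟨hL, w, hw, hM⟩
      exact MP.check_sound h hL w hw hM
    · intro h
      by_cases hL : ∀ p ∈ L, MP.tdet p ≠ 0
      · obtain ⟨S, R, hC⟩ := MP.check_complete (L := L) (M := M) (fun hw => h ⟨hL, hw⟩)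
        exact ⟨(S, R), hC⟩
      · push Not at hL
        exact ⟨([], []), Or.inl hL⟩
end

section
/- The membership problem for GL(2,ℤ) is decidable. Precisely, the predicate P on pairs (L, M), where L is a finite list of 2×2 integer matrices and M is a 2×2 integer matrix (matrices encoded as 4-tuples of integers so that the pairs form an encodable type), defined by P(L, M) := "every matrix in L and the matrix M have determinant 1 or −1, and M belongs to the multiplicative monoid generated by the matrices in L (i.e., M is the identity matrix or a finite product of matrices from L)", is a computable predicate in the recursion-theoretic sense (ComputablePred). -/
/-! ### Abstract part: a group acting on a rooted tree -/

section TreeAbstract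

variable {V : Type*} (π : V → V) (o : V)

/-- Two vertices are at tree-distance at most `n`. -/
def AncRel (n : ℕ) (x y : V) : Prop := ∃ i j, i + j ≤ n ∧ π^[i] x = π^[j] y

lemma AncRel.step {n : ℕ} {x y z : V} (h : AncRel π n x y)
    (hz : z = y ∨ π z = y ∨ π y = z) : AncRel π (n + 1) x z := by
  obtain ⟨i, j, hij, he⟩ := h
  rcases hz with rfl | hz | hz
  · exact ⟨i, j, by omega, he⟩
  · refine ⟨i, j + 1, by omega, ?_⟩
    rw [he, Function.iterate_succ_apply, hz]
  · rcases j with _ | j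
    · refine ⟨i + 1, 0, by omega, ?_⟩
      rw [Function.iterate_succ_apply', he]
      exact hz
    · refine ⟨i, j, by omega, ?_⟩
      rw [he, Function.iterate_succ_apply, hz]

variable (ho : π o = o) (hex : ∀ x, ∃ n, π^[n] x = o)

open Classical in
/-- Depth of a vertex in the rooted tree. -/
noncomputable def tdepth (x : V) : ℕ := Nat.find (hex x)

open Classical in
lemma tdepth_spec (x : V) : π^[tdepth π o hex x] x = o := Nat.find_spec (hex x)

open Classical in
lemma tdepth_le {x : V} {n : ℕ} (h : π^[n] x = o) : tdepth π o hex x ≤ n := Nat.find_min' _ h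

include ho in
lemma iter_root (n : ℕ) : π^[n] o = o := Function.iterate_fixed ho n

include ho in
lemma iter_ge {x : V} {n : ℕ} (h : tdepth π o hex x ≤ n) : π^[n] x = o := by
  obtain ⟨k, rfl⟩ := Nat.exists_eq_add_of_le h
  rw [Nat.add_comm, Function.iterate_add_apply, tdepth_spec, iter_root π o ho]

include ho in
lemma tdepth_iter (x : V) (n : ℕ) : tdepth π o hex (π^[n] x) = tdepth π o hex x - n := by
  apply le_antisymm
  · apply tdepth_le
    rw [← Function.iterate_add_apply]
    apply iter_ge π o ho hex
    omega
  · have : tdepth π o hex x ≤ tdepth π o hex (π^[n] x) + n := by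
      apply tdepth_le
      rw [Function.iterate_add_apply, tdepth_spec]
    omega

include ho in
/-- normalise the meeting point -/
lemma AncRel.norm {n : ℕ} {v u : V} (h : AncRel π n v u)
    (hd : tdepth π o hex u ≤ tdepth π o hex v) :
    ∃ i j, i + j ≤ n ∧ j ≤ i ∧ π^[i] v = π^[j] u := by
  obtain ⟨i, j, hij, he⟩ := h
  have h1 := tdepth_iter π o ho hex v i
  have h2 := tdepth_iter π o ho hex u j
  rw [he] at h1
  by_cases hji : j ≤ i
  · exact ⟨i, j, hij, hji, he⟩
  · have hv : tdepth π o hex v ≤ i := by omega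
    have hu : tdepth π o hex u ≤ i := by omega
    refine ⟨i, i, by omega, le_rfl, ?_⟩
    rw [iter_ge π o ho hex hv, iter_ge π o ho hex hu]

include ho in
lemma AncRel.ear {n : ℕ} {u v w : V} (h1 : AncRel π n v u) (h2 : AncRel π n v w)
    (hu : tdepth π o hex u ≤ tdepth π o hex v) (hw : tdepth π o hex w ≤ tdepth π o hex v) :
    AncRel π n u w := by
  obtain ⟨i, j, hij, hji, he⟩ := h1.norm π o ho hex hu
  obtain ⟨i', j', hij', hji', he'⟩ := h2.norm π o ho hex hw
  rcases le_total i i' with hii | hii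
  · obtain ⟨k, rfl⟩ := Nat.exists_eq_add_of_le hii
    refine ⟨k + j, j', by omega, ?_⟩
    rw [← he', Function.iterate_add_apply, ← he, ← Function.iterate_add_apply, Nat.add_comm]
  · obtain ⟨k, rfl⟩ := Nat.exists_eq_add_of_le hii
    refine ⟨j, k + j', by omega, ?_⟩
    rw [← he, Function.iterate_add_apply _ k j', ← he', ← Function.iterate_add_apply, Nat.add_comm]

end TreeAbstract

open scoped Pointwise

/-- The data needed for the local-closure theorem. -/
structure TreeData (G : Type*) [Group G] (V : Type*) where
  P : Set G
  τ : G → V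
  π : V → V
  one_mem : (1 : G) ∈ P
  inv_mem : ∀ g ∈ P, g⁻¹ ∈ P
  absorb : ∀ g h k : G, τ g = τ h → h⁻¹ * k ∈ P → g⁻¹ * k ∈ P
  adj : ∀ g h : G, g⁻¹ * h ∈ P → τ h = τ g ∨ π (τ h) = τ g ∨ π (τ g) = τ h
  par : ∀ g, ∃ g', τ g' = π (τ g) ∧ g⁻¹ * g' ∈ P
  root : π (τ 1) = τ 1
  ex : ∀ x, ∃ n, π^[n] x = τ 1

namespace TreeData

variable {G : Type*} [Group G] {V : Type*} (D : TreeData G V)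

lemma inv_pow {n : ℕ} {g : G} (hg : g ∈ D.P ^ n) : g⁻¹ ∈ D.P ^ n := by
  have hP : D.P⁻¹ = D.P := by
    ext x
    constructor
    · intro h
      have := D.inv_mem _ h
      simpa using this
    · intro h
      exact D.inv_mem _ h
  rw [← hP, _root_.inv_pow]
  simpa using hg

lemma ball_anc (n : ℕ) (g h : G) (hgh : g⁻¹ * h ∈ D.P ^ n) : AncRel D.π n (D.τ g) (D.τ h) := by
  induction n generalizing h with
  | zero =>
    have : g⁻¹ * h = 1 := by simpa using hgh
    rw [inv_mul_eq_one] at this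
    subst this
    exact ⟨0, 0, le_rfl, rfl⟩
  | succ n ih =>
    rw [pow_succ] at hgh
    obtain ⟨a, ha, b, hb, hab⟩ := Set.mem_mul.1 hgh
    have hh : h = g * a * b := by
      rw [mul_assoc, hab]; group
    refine AncRel.step D.π (ih (g * a) (by simpa using ha)) (D.adj _ _ ?_)
    rw [hh, inv_mul_cancel_left]; exact hb

lemma chain (g : G) (n : ℕ) : ∃ g', D.τ g' = D.π^[n] (D.τ g) ∧ g⁻¹ * g' ∈ D.P ^ n := by
  induction n with
  | zero => exact ⟨g, rfl, by simp⟩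
  | succ n ih =>
    obtain ⟨g', h1, h2⟩ := ih
    obtain ⟨g'', h3, h4⟩ := D.par g'
    refine ⟨g'', ?_, ?_⟩
    · rw [h3, h1, Function.iterate_succ_apply']
    · rw [pow_succ]
      exact Set.mem_mul.2 ⟨_, h2, _, h4, by group⟩

lemma absorb_pow {n : ℕ} (hn : 1 ≤ n) {g h k : G} (hgh : D.τ g = D.τ h) (hk : h⁻¹ * k ∈ D.P ^ n) :
    g⁻¹ * k ∈ D.P ^ n := by
  obtain ⟨m, rfl⟩ := Nat.exists_eq_add_of_le hn
  rw [pow_add, pow_one] at hk ⊢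
  obtain ⟨a, ha, b, hb, hab⟩ := Set.mem_mul.1 hk
  have := D.absorb g h (h * a) hgh (by simpa using ha)
  refine Set.mem_mul.2 ⟨_, this, b, hb, ?_⟩
  have hk' : k = h * (a * b) := by rw [hab]; group
  rw [hk']; group

lemma pow_mono {m n : ℕ} (h : m ≤ n) : D.P ^ m ⊆ D.P ^ n :=
  Set.pow_subset_pow_right D.one_mem h

lemma anc_ball {n : ℕ} (hn : 1 ≤ n) (g h : G) (hgh : AncRel D.π n (D.τ g) (D.τ h)) :
    g⁻¹ * h ∈ D.P ^ n := by
  obtain ⟨i, j, hij, he⟩ := hgh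
  obtain ⟨g', h1, h2⟩ := D.chain g i
  obtain ⟨h', h3, h4⟩ := D.chain h j
  have heq : D.τ g' = D.τ h' := by rw [h1, h3, he]
  have h5 := D.inv_pow h4
  rw [mul_inv_rev, inv_inv] at h5
  have h6 : h'⁻¹ * h ∈ D.P ^ (n - i) := D.pow_mono (by omega) h5
  by_cases hni : 1 ≤ n - i
  · have h7 := D.absorb_pow hni heq h6
    have : n = i + (n - i) := by omega
    rw [this, pow_add]
    exact Set.mem_mul.2 ⟨_, h2, _, h7, by group⟩
  · have hj : j = 0 := by omega
    have hi : i = n := by omega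
    subst hj hi
    have h8 : h'⁻¹ * h = 1 := by simpa using h5
    rw [inv_mul_eq_one] at h8
    subst h8
    have h9 := D.absorb_pow (k := g) hn heq.symm (by
      have := D.inv_pow h2
      simpa using this)
    have := D.inv_pow h9
    simpa using this

/-- Depth of a group element. -/
noncomputable def dep (g : G) : ℕ := tdepth D.π (D.τ 1) D.ex (D.τ g)

lemma mem_ball_iff {n : ℕ} (hn : 1 ≤ n) (g : G) : g ∈ D.P ^ n ↔ D.dep g ≤ n := by
  constructor
  · intro h
    obtain ⟨i, j, hij, he⟩ := D.ball_anc n 1 g (by simpa using h)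
    rw [iter_root _ _ D.root] at he
    exact (tdepth_le _ _ _ he.symm).trans (by omega)
  · intro h
    have := D.anc_ball hn 1 g ⟨0, n, by omega, by
      rw [iter_ge _ _ D.root D.ex h]; rfl⟩
    simpa using this

lemma ear {n : ℕ} (hn : 1 ≤ n) (v a b : G) (ha : a ∈ D.P ^ n) (hb : b ∈ D.P ^ n)
    (h1 : D.dep v ≤ D.dep (v * a)) (h2 : D.dep (v * a * b) ≤ D.dep (v * a)) :
    a * b ∈ D.P ^ n := by
  have k1 := D.ball_anc n (v * a) v (by simpa using D.inv_pow ha)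
  have k2 := D.ball_anc n (v * a) (v * a * b) (by rw [inv_mul_cancel_left]; exact hb)
  have := D.anc_ball hn _ _ (AncRel.ear _ _ D.root D.ex k1 k2 h1 h2)
  simpa [mul_assoc] using this

/-- A list with product in the ball has two adjacent letters whose product is in the ball. -/
lemma exists_merge {n : ℕ} (hn : 1 ≤ n) (l : List G) (hl : ∀ g ∈ l, g ∈ D.P ^ n)
    (hlen : 2 ≤ l.length) (hp : l.prod ∈ D.P ^ n) :
    ∃ l1 a b l2, l = l1 ++ a :: b :: l2 ∧ a * b ∈ D.P ^ n := by
  obtain ⟨i, hi, hmax⟩ := Finset.exists_max_image (Finset.range (l.length + 1))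
    (fun i => D.dep (l.take i).prod) ⟨0, by simp⟩
  rw [Finset.mem_range] at hi
  by_cases hK : D.dep (l.take i).prod ≤ n
  · match l, hlen, hmax with
    | a :: b :: l2, _, hmax =>
      refine ⟨[], a, b, l2, rfl, ?_⟩
      rw [D.mem_ball_iff hn]
      have := hmax 2 (by simp)
      simp at this
      exact this.trans hK
  · have hi0 : i ≠ 0 := by
      rintro rfl
      apply hK
      rw [← D.mem_ball_iff hn]
      simpa using D.pow_mono (Nat.zero_le n) (by simp)
    have hil : i ≠ l.length := by
      rintro rfl
      apply hK
      rw [← D.mem_ball_iff hn]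
      simpa using hp
    obtain ⟨m, rfl⟩ := Nat.exists_eq_succ_of_ne_zero hi0
    have hm : m < l.length := by omega
    have hm1 : m + 1 < l.length := by omega
    refine ⟨l.take m, l[m], l[m + 1], l.drop (m + 2), ?_, ?_⟩
    · rw [← List.drop_eq_getElem_cons hm1, ← List.drop_eq_getElem_cons hm, List.take_append_drop]
    · have e1 : (l.take (m + 1)).prod = (l.take m).prod * l[m] := by
        rw [List.prod_take_succ]
      have e2 : (l.take (m + 2)).prod = (l.take m).prod * l[m] * l[m + 1] := by
        rw [List.prod_take_succ _ _ hm1, e1]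
      have h1 := hmax m (by simp; omega)
      have h2 := hmax (m + 2) (by simp; omega)
      rw [e2] at h2
      simp only [Nat.succ_eq_add_one, e1] at h1 h2
      exact D.ear hn _ _ _ (hl _ (List.getElem_mem _)) (hl _ (List.getElem_mem _)) h1 h2

/-- Local closure theorem. -/
lemma local_closure {n : ℕ} (hn : 1 ≤ n) (T : Set G) (h1 : 1 ∈ T)
    (hT : ∀ a ∈ T, a ∈ D.P ^ n) (hc : ∀ a ∈ T, ∀ b ∈ T, a * b ∈ D.P ^ n → a * b ∈ T)
    (l : List G) (hl : ∀ g ∈ l, g ∈ T) (hp : l.prod ∈ D.P ^ n) : l.prod ∈ T := by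
  induction hk : l.length generalizing l with
  | zero =>
    rw [List.length_eq_zero_iff] at hk
    subst hk
    simpa using h1
  | succ k ih =>
    by_cases hlen : 2 ≤ l.length
    · obtain ⟨l1, a, b, l2, rfl, hab⟩ := D.exists_merge hn l (fun g hg => hT g (hl g hg)) hlen hp
      have e : (l1 ++ a :: b :: l2).prod = (l1 ++ (a * b) :: l2).prod := by
        simp [mul_assoc]
      rw [e] at hp ⊢
      apply ih _ _ hp
      · simp at hk ⊢; omega
      · intro g hg
        simp only [List.mem_append, List.mem_cons] at hg hl
        rcases hg with hg | rfl | hg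
        · exact hl g (by simp [hg])
        · exact hc _ (hl a (by simp)) _ (hl b (by simp)) hab
        · exact hl g (by simp [hg])
    · match l, hk with
      | [a], _ => simpa using hl a (by simp)
      | a :: b :: l, _ => simp at hlen

end TreeData

/-! ### Concrete part: the topograph of `GL(2,ℤ)` -/

namespace Topo

abbrev M := Matrix (Fin 2) (Fin 2) ℤ
abbrev G := Mˣ

/-- Selling parameters of a superbase. -/
def cc (m : M) : ℤ := -(2 * m 0 0 * m 0 1 - m 0 0 * m 1 1 - m 1 0 * m 0 1 + 2 * m 1 0 * m 1 1)
def aa (m : M) : ℤ := 2 * (m 0 1 ^ 2 - m 0 1 * m 1 1 + m 1 1 ^ 2) - cc m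
def bb (m : M) : ℤ := 2 * (m 0 0 ^ 2 - m 0 0 * m 1 0 + m 1 0 ^ 2) - cc m

lemma sell (m : M) : aa m * bb m + bb m * cc m + cc m * aa m = 3 * m.det ^ 2 := by
  rw [Matrix.det_fin_two]
  simp only [aa, bb, cc]
  ring

lemma det_sq (g : G) : (g : M).det ^ 2 = 1 := by
  have : IsUnit (g : M).det := (Matrix.isUnit_iff_isUnit_det _).1 g.isUnit
  rw [Int.isUnit_iff] at this
  rcases this with h | h <;> rw [h] <;> norm_num

lemma sell3 (g : G) : aa g * bb g + bb g * cc g + cc g * aa g = 3 := by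
  rw [sell, det_sq]; norm_num

lemma ac_even (m : M) : ∃ k, aa m + cc m = 2 * k := ⟨m 0 1 ^ 2 - m 0 1 * m 1 1 + m 1 1 ^ 2, by simp only [aa]; ring⟩
lemma bc_even (m : M) : ∃ k, bb m + cc m = 2 * k := ⟨m 0 0 ^ 2 - m 0 0 * m 1 0 + m 1 0 ^ 2, by simp only [bb]; ring⟩

lemma ac_nonneg (m : M) : 0 ≤ aa m + cc m := by
  simp only [aa]
  nlinarith [sq_nonneg (m 0 1 - m 1 1), sq_nonneg (m 0 1), sq_nonneg (m 1 1)]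

lemma bc_nonneg (m : M) : 0 ≤ bb m + cc m := by
  simp only [bb]
  nlinarith [sq_nonneg (m 0 0 - m 1 0), sq_nonneg (m 0 0), sq_nonneg (m 1 0)]

lemma ab_nonneg (m : M) : 0 ≤ aa m + bb m := by
  simp only [aa, bb, cc]
  nlinarith [sq_nonneg (m 0 0 + m 0 1 - m 1 0 - m 1 1), sq_nonneg (m 0 0 + m 0 1), sq_nonneg (m 1 0 + m 1 1)]

lemma cc_ne (g : G) : cc g ≠ 0 := by
  intro h
  have h1 := sell3 g
  obtain ⟨k, hk⟩ := ac_even g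
  rw [h] at h1 hk
  have : 2 * (k * bb g) = 3 := by
    rw [← h1, add_zero] at *
    rw [hk]; ring
  omega

lemma all_pos (g : G) (ha : 0 < aa g) (hb : 0 < bb g) (hc : 0 < cc g) :
    aa g = 1 ∧ bb g = 1 ∧ cc g = 1 := by
  have h1 := sell3 g
  have : aa g ≤ 1 ∧ bb g ≤ 1 ∧ cc g ≤ 1 := by
    refine ⟨?_, ?_, ?_⟩ <;> by_contra! h <;>
      nlinarith [mul_pos ha hb, mul_pos hb hc, mul_pos hc ha]
  omega

def B : M := !![2, -1; -1, 2]

lemma B_iff (m : M) : m.transpose * B * m = B ↔ aa m = 1 ∧ bb m = 1 ∧ cc m = 1 := by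
  have e : m.transpose * B * m = !![bb m + cc m, - cc m; - cc m, aa m + cc m] := by
    ext i j
    fin_cases i <;> fin_cases j <;>
      simp [B, aa, bb, cc, Matrix.mul_apply, Fin.sum_univ_two] <;> ring
  rw [e, B]
  constructor
  · intro h
    have h1 := congrFun (congrFun h 0) 0
    have h2 := congrFun (congrFun h 0) 1
    have h3 := congrFun (congrFun h 1) 1
    simp at h1 h2 h3
    omega
  · rintro ⟨h1, h2, h3⟩
    rw [h1, h2, h3]; norm_num

/-- Stabilizer of the root superbase. -/
def H : Subgroup G where
  carrier := {g | (g : M).transpose * B * g = B}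
  one_mem' := by simp
  mul_mem' := by
    intro a b ha hb
    simp only [Set.mem_ofPred_eq, Units.val_mul, Matrix.transpose_mul] at *
    calc _ = (b : M).transpose * ((a : M).transpose * B * a) * b := by simp only [mul_assoc]
      _ = B := by rw [ha, hb]
  inv_mem' := by
    intro a ha
    simp only [Set.mem_ofPred_eq] at *
    have h1 : (a : M) * ((a⁻¹ : G) : M) = 1 := by simp
    have h2 : ((a⁻¹ : G) : M).transpose * (a : M).transpose = 1 := by
      rw [← Matrix.transpose_mul, h1, Matrix.transpose_one]
    calc ((a⁻¹ : G) : M).transpose * B * ((a⁻¹ : G) : M)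
        = ((a⁻¹ : G) : M).transpose * ((a : M).transpose * B * a) * ((a⁻¹ : G) : M) := by rw [ha]
      _ = (((a⁻¹ : G) : M).transpose * (a : M).transpose) * B * ((a : M) * ((a⁻¹ : G) : M)) := by
          simp only [mul_assoc]
      _ = B := by rw [h1, h2]; simp

lemma mem_H (g : G) : g ∈ H ↔ aa g = 1 ∧ bb g = 1 ∧ cc g = 1 := B_iff g

/-- The twelve elements of `H` as tuples. -/
def Hl : List (ℤ × ℤ × ℤ × ℤ) :=
  [(1, 0, 0, 1), (0, -1, 1, -1), (-1, 1, -1, 0), (-1, 0, 0, -1), (0, 1, -1, 1), (1, -1, 1, 0),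
   (0, 1, 1, 0), (-1, 0, -1, 1), (1, -1, 0, -1), (0, -1, -1, 0), (1, 0, 1, -1), (-1, 1, 0, 1)]

lemma vec6 (x y : ℤ) (h : x ^ 2 - x * y + y ^ 2 = 1) :
    (x, y) ∈ [((1 : ℤ), (0 : ℤ)), (0, 1), (1, 1), (-1, 0), (0, -1), (-1, -1)] := by
  have h1 : -1 ≤ x := by nlinarith [sq_nonneg (x - 2 * y)]
  have h2 : x ≤ 1 := by nlinarith [sq_nonneg (x - 2 * y)]
  have h3 : -1 ≤ y := by nlinarith [sq_nonneg (2 * x - y)]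
  have h4 : y ≤ 1 := by nlinarith [sq_nonneg (2 * x - y)]
  interval_cases x <;> interval_cases y <;> simp_all

lemma H_enum (m : M) (h : aa m = 1 ∧ bb m = 1 ∧ cc m = 1) :
    (m 0 0, m 0 1, m 1 0, m 1 1) ∈ Hl := by
  obtain ⟨h1, h2, h3⟩ := h
  have k1 := vec6 (m 0 0) (m 1 0) (by simp only [bb] at h2; linarith)
  have k2 := vec6 (m 0 1) (m 1 1) (by simp only [aa] at h1; linarith)
  simp only [cc] at h3
  generalize m 0 0 = x at *
  generalize m 0 1 = y at *
  generalize m 1 0 = z at *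
  generalize m 1 1 = w at *
  simp only [List.mem_cons, Prod.mk.injEq, List.not_mem_nil, or_false] at k1 k2
  rcases k1 with k1 | k1 | k1 | k1 | k1 | k1 <;> rcases k2 with k2 | k2 | k2 | k2 | k2 | k2 <;>
    (obtain ⟨rfl, rfl⟩ := k1; obtain ⟨rfl, rfl⟩ := k2; revert h3; decide)

lemma Hl_spec : ∀ t ∈ Hl, aa (tupToMat t) = 1 ∧ bb (tupToMat t) = 1 ∧ cc (tupToMat t) = 1 := by
  decide

def sM : M := !![1, 0; 0, -1]
def s : G := ⟨sM, sM, by decide, by decide⟩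
def rM : M := !![0, -1; 1, -1]
def r : G := ⟨rM, rM * rM, by decide, by decide⟩

lemma s_s : s * s = 1 := by ext1; decide
lemma s_inv : s⁻¹ = s := by rw [inv_eq_iff_mul_eq_one, s_s]
lemma r_mem : r ∈ H := by rw [mem_H]; decide

lemma cc_s (g : G) : cc (g * s : G) = - cc g := by
  simp [cc, s, sM, Matrix.mul_apply, Fin.sum_univ_two]; ring
lemma aa_s (g : G) : aa (g * s : G) = aa g + 2 * cc g := by
  simp [aa, cc, s, sM, Matrix.mul_apply, Fin.sum_univ_two]; ring
lemma bb_s (g : G) : bb (g * s : G) = bb g + 2 * cc g := by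
  simp [bb, cc, s, sM, Matrix.mul_apply, Fin.sum_univ_two]; ring
lemma cc_r (g : G) : cc (g * r : G) = aa g := by
  simp [aa, cc, r, rM, Matrix.mul_apply, Fin.sum_univ_two]; ring
lemma aa_r (g : G) : aa (g * r : G) = bb g := by
  simp [aa, bb, cc, r, rM, Matrix.mul_apply, Fin.sum_univ_two]; ring
lemma bb_r (g : G) : bb (g * r : G) = cc g := by
  simp [bb, cc, r, rM, Matrix.mul_apply, Fin.sum_univ_two]; ring

/-- If both `g` and `g * k` face the parent, then `s * k * s` stabilises the root. -/
lemma key (g k : G) (hk : k ∈ H) (h1 : cc g < 0) (h2 : cc (g * k : G) < 0) : s * k * s ∈ H := by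
  have hac := ac_nonneg g
  have hbc := bc_nonneg g
  have e := H_enum k ((mem_H k).1 hk)
  have e2 : cc (g * k : G) = cc ((g : M) * !![(k : M) 0 0, (k : M) 0 1; (k : M) 1 0, (k : M) 1 1]) := by
    rw [← Matrix.eta_fin_two]; rfl
  have e3 : ((s * k * s : G) : M) = sM * !![(k : M) 0 0, (k : M) 0 1; (k : M) 1 0, (k : M) 1 1] * sM := by
    rw [← Matrix.eta_fin_two]; rfl
  rw [mem_H, e3]
  rw [e2] at h2
  generalize (k : M) 0 0 = x at *
  generalize (k : M) 0 1 = y at *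
  generalize (k : M) 1 0 = z at *
  generalize (k : M) 1 1 = w at *
  clear e2 e3
  simp only [Hl, List.mem_cons, Prod.mk.injEq, List.not_mem_nil, or_false] at e
  simp only [aa, bb] at hac hbc
  rcases e with e | e | e | e | e | e | e | e | e | e | e | e <;>
    obtain ⟨rfl, rfl, rfl, rfl⟩ := e <;> first
      | decide
      | (exfalso
         simp [cc, Matrix.mul_apply, Fin.sum_univ_two] at h1 h2 hac hbc
         nlinarith)

end Topo

namespace Topo

/-- vertices of the tree -/
abbrev V := G ⧸ H

lemma q_mul (g k : G) (hk : k ∈ H) : ((g * k : G) : V) = (g : V) := by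
  rw [QuotientGroup.eq]
  simpa using H.inv_mem hk

open Classical in
/-- parent map -/
noncomputable def par (x : V) : V :=
  if h : ∃ g : G, (g : V) = x ∧ cc g < 0 then ((h.choose * s : G) : V) else x

lemma par_neg (g : G) (h : cc g < 0) : par (g : V) = ((g * s : G) : V) := by
  have hex : ∃ g' : G, (g' : V) = (g : V) ∧ cc g' < 0 := ⟨g, rfl, h⟩
  rw [par, dif_pos hex]
  obtain ⟨h1, h2⟩ := hex.choose_spec
  generalize hex.choose = g' at *
  rw [QuotientGroup.eq] at h1 ⊢
  have := key g' (g'⁻¹ * g) h1 h2 (by simpa using h)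
  rw [mul_inv_rev, s_inv]
  simpa [mul_assoc] using this

lemma par_root : par ((1 : G) : V) = ((1 : G) : V) := by
  rw [par, dif_neg]
  rintro ⟨g, h1, h2⟩
  rw [QuotientGroup.eq] at h1
  have h3 : g ∈ H := by simpa using h1
  rw [mem_H] at h3
  omega

lemma cases_g (g : G) : g ∈ H ∨ ∃ k ∈ H, cc (g * k : G) < 0 ∧
    aa (g * k : G) + bb (g * k : G) + cc (g * k : G) = aa g + bb g + cc g := by
  by_cases hc : cc g < 0
  · exact Or.inr ⟨1, H.one_mem, by simpa using hc, by simp⟩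
  by_cases ha : cc (g * r : G) < 0
  · exact Or.inr ⟨r, r_mem, ha, by rw [cc_r, aa_r, bb_r]; ring⟩
  by_cases hb : cc (g * r * r : G) < 0
  · exact Or.inr ⟨r * r, H.mul_mem r_mem r_mem, by rw [← mul_assoc]; exact hb, by
      rw [← mul_assoc]
      have := cc_r (g * r); have := aa_r (g * r); have := bb_r (g * r)
      have := cc_r g; have := aa_r g; have := bb_r g
      omega⟩
  left
  have hc' := cc_ne g
  have ha' := cc_ne (g * r)
  have hb' := cc_ne (g * r * r)
  rw [cc_r] at ha ha' hb hb'
  rw [aa_r] at hb hb'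
  rw [mem_H]
  exact all_pos g (by omega) (by omega) (by omega)

lemma par_ex (x : V) : ∃ n, par^[n] x = ((1 : G) : V) := by
  induction x using QuotientGroup.induction_on with
  | H g =>
  obtain ⟨N, hN⟩ : ∃ N : ℕ, aa g + bb g + cc g ≤ N :=
    ⟨(aa g + bb g + cc g).toNat, Int.self_le_toNat _⟩
  induction N using Nat.strong_induction_on generalizing g with
  | _ N ih =>
    rcases cases_g g with hg | ⟨k, hk, hc, hs⟩
    · refine ⟨0, ?_⟩
      simp only [Function.iterate_zero, id]
      rw [QuotientGroup.eq]
      simpa using H.inv_mem hg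
    · have e1 := cc_s (g * k)
      have e2 := aa_s (g * k)
      have e3 := bb_s (g * k)
      have h1 := ac_nonneg (g * k * s : G)
      have h2 := bc_nonneg (g * k * s : G)
      have h3 := ab_nonneg (g * k * s : G)
      obtain ⟨n, hn⟩ := ih (N - 1) (by omega) (g * k * s) (by omega)
      refine ⟨n + 1, ?_⟩
      rw [Function.iterate_succ_apply, ← q_mul g k hk, par_neg _ hc, hn]

/-- The generating set. -/
def P : Set G := {x | x ∈ H ∨ ∃ k ∈ H, ∃ k' ∈ H, x = k * s * k'}

lemma P_left (k x : G) (hk : k ∈ H) (hx : x ∈ P) : k * x ∈ P := by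
  rcases hx with h | ⟨a, ha, b, hb, rfl⟩
  · exact Or.inl (H.mul_mem hk h)
  · exact Or.inr ⟨k * a, H.mul_mem hk ha, b, hb, by simp only [mul_assoc]⟩

/-- Tree data of `GL(2,ℤ)`. -/
noncomputable def D : TreeData G V where
  P := P
  τ := fun g => (g : V)
  π := par
  one_mem := Or.inl H.one_mem
  inv_mem := by
    rintro g (h | ⟨a, ha, b, hb, rfl⟩)
    · exact Or.inl (H.inv_mem h)
    · refine Or.inr ⟨b⁻¹, H.inv_mem hb, a⁻¹, H.inv_mem ha, ?_⟩
      rw [mul_inv_rev, mul_inv_rev, s_inv, mul_assoc]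
  absorb := by
    intro g h k hgh hk
    rw [QuotientGroup.eq] at hgh
    have := P_left _ _ hgh hk
    simpa [mul_assoc] using this
  adj := by
    rintro g h (hh | ⟨a, ha, b, hb, hab⟩)
    · exact Or.inl (QuotientGroup.eq.2 hh).symm
    · right
      have e : h = g * a * s * b := by
        rw [inv_mul_eq_iff_eq_mul] at hab
        rw [hab]; simp only [mul_assoc]
      have e1 : (h : V) = ((g * a * s : G) : V) := by rw [e, q_mul _ _ hb]
      have e2 : (g : V) = ((g * a : G) : V) := by rw [q_mul _ _ ha]
      rw [e1, e2]
      rcases lt_or_gt_of_ne (cc_ne (g * a)) with hc | hc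
      · right; exact par_neg _ hc
      · left
        rw [par_neg _ (by rw [cc_s]; omega), mul_assoc, s_s, mul_one]
  par := by
    intro g
    rcases cases_g g with hg | ⟨k, hk, hc, -⟩
    · refine ⟨g, ?_, by rw [inv_mul_cancel]; exact Or.inl H.one_mem⟩
      have : (g : V) = ((1 : G) : V) := by
        rw [QuotientGroup.eq]; simpa using H.inv_mem hg
      rw [this, par_root]
    · refine ⟨g * k * s, ?_, Or.inr ⟨k, hk, 1, H.one_mem, by group⟩⟩
      rw [← q_mul g k hk, par_neg _ hc]
  root := par_root
  ex := par_ex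

/-! Tuples -/

abbrev Tup := ℤ × ℤ × ℤ × ℤ

def tmul (p q : Tup) : Tup :=
  (p.1 * q.1 + p.2.1 * q.2.2.1, p.1 * q.2.1 + p.2.1 * q.2.2.2,
   p.2.2.1 * q.1 + p.2.2.2 * q.2.2.1, p.2.2.1 * q.2.1 + p.2.2.2 * q.2.2.2)

def tone : Tup := (1, 0, 0, 1)

def tdet (p : Tup) : ℤ := p.1 * p.2.2.2 + (-1) * (p.2.1 * p.2.2.1)

lemma tmul_spec (p q : Tup) : tupToMat (tmul p q) = tupToMat p * tupToMat q := by
  simp [tupToMat, tmul]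

lemma tone_spec : tupToMat tone = 1 := by
  decide

lemma tdet_spec (p : Tup) : (tupToMat p).det = tdet p := by
  simp [tupToMat, tdet, Matrix.det_fin_two]; ring

lemma tup_inj {p q : Tup} (h : tupToMat p = tupToMat q) : p = q := by
  have h1 := congrFun (congrFun h 0) 0
  have h2 := congrFun (congrFun h 0) 1
  have h3 := congrFun (congrFun h 1) 0
  have h4 := congrFun (congrFun h 1) 1
  simp [tupToMat] at h1 h2 h3 h4
  exact Prod.ext h1 (Prod.ext h2 (Prod.ext h3 h4))

def lmul (A B : List Tup) : List Tup := A.flatMap fun a => B.map fun b => tmul a b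

lemma mem_lmul (A B : List Tup) (t : Tup) :
    t ∈ lmul A B ↔ ∃ a ∈ A, ∃ b ∈ B, tmul a b = t := by
  simp [lmul]

/-- A list of tuples represents a set of group elements. -/
def Rep (A : List Tup) (S : Set G) : Prop :=
  ∀ t : Tup, t ∈ A ↔ ∃ g ∈ S, tupToMat t = (g : M)

lemma mat_tup (m : M) : tupToMat (m 0 0, m 0 1, m 1 0, m 1 1) = m := by
  rw [tupToMat]; exact (Matrix.eta_fin_two m).symm

open scoped Pointwise

lemma Rep.mul {A B : List Tup} {S T : Set G} (hA : Rep A S) (hB : Rep B T) :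
    Rep (lmul A B) (S * T) := by
  intro t
  rw [mem_lmul]
  constructor
  · rintro ⟨a, ha, b, hb, rfl⟩
    obtain ⟨g, hg, e⟩ := (hA a).1 ha
    obtain ⟨h, hh, e'⟩ := (hB b).1 hb
    exact ⟨g * h, Set.mul_mem_mul hg hh, by rw [tmul_spec, e, e', Units.val_mul]⟩
  · rintro ⟨x, hx, e⟩
    obtain ⟨g, hg, h, hh, rfl⟩ := Set.mem_mul.1 hx
    refine ⟨_, (hA _).2 ⟨g, hg, mat_tup g⟩, _, (hB _).2 ⟨h, hh, mat_tup h⟩, ?_⟩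
    apply tup_inj
    rw [tmul_spec, mat_tup, mat_tup, e, Units.val_mul]

lemma Rep.union {A B : List Tup} {S T : Set G} (hA : Rep A S) (hB : Rep B T) :
    Rep (A ++ B) (S ∪ T) := by
  intro t
  rw [List.mem_append, hA t, hB t]
  constructor
  · rintro (⟨g, hg, e⟩ | ⟨g, hg, e⟩)
    · exact ⟨g, Or.inl hg, e⟩
    · exact ⟨g, Or.inr hg, e⟩
  · rintro ⟨g, hg | hg, e⟩
    · exact Or.inl ⟨g, hg, e⟩
    · exact Or.inr ⟨g, hg, e⟩

lemma Rep.single {t : Tup} {g : G} (h : tupToMat t = (g : M)) : Rep [t] {g} := by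
  intro t'
  simp only [List.mem_singleton, Set.mem_singleton_iff, exists_eq_left]
  constructor
  · rintro rfl; exact h
  · intro h'; exact tup_inj (h'.trans h.symm)

lemma unit_of_det {t : Tup} (h : tdet t = 1 ∨ tdet t = -1) : ∃ g : G, tupToMat t = (g : M) := by
  have : IsUnit (tupToMat t) := by
    rw [Matrix.isUnit_iff_isUnit_det, tdet_spec, Int.isUnit_iff]
    exact h
  exact ⟨this.unit, rfl⟩

lemma Hl_det : ∀ t ∈ Hl, tdet t = 1 ∨ tdet t = -1 := by decide

lemma rep_H : Rep Hl (H : Set G) := by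
  intro t
  constructor
  · intro ht
    obtain ⟨g, hg⟩ := unit_of_det (Hl_det t ht)
    refine ⟨g, ?_, hg⟩
    rw [SetLike.mem_coe, mem_H, ← hg]
    exact Hl_spec t ht
  · rintro ⟨g, hg, e⟩
    have := H_enum g ((mem_H g).1 hg)
    rw [← mat_tup g] at e
    rwa [tup_inj e]

def Pl : List Tup := Hl ++ lmul (lmul Hl [(1, 0, 0, -1)]) Hl

lemma rep_P : Rep Pl P := by
  have h1 : Rep [(1, 0, 0, -1)] ({s} : Set G) := Rep.single (by decide)
  have := rep_H.union ((rep_H.mul h1).mul rep_H)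
  have e : P = (H : Set G) ∪ ((H : Set G) * {s}) * (H : Set G) := ?_
  · rw [e]; exact this
  ext x
  rw [Set.mem_union, Set.mem_mul]
  constructor
  · rintro (h | ⟨k, hk, k', hk', rfl⟩)
    · exact Or.inl h
    · exact Or.inr ⟨k * s, ⟨k, hk, s, rfl, rfl⟩, k', hk', rfl⟩
  · rintro (h | ⟨_, ⟨k, hk, _, rfl, rfl⟩, k', hk', rfl⟩)
    · exact Or.inl h
    · exact Or.inr ⟨k, hk, k', hk', rfl⟩

def ball (n : ℕ) : List Tup := Nat.rec [tone] (fun _ B => lmul B Pl) n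

lemma rep_ball (n : ℕ) : Rep (ball n) (D.P ^ n) := by
  induction n with
  | zero => rw [pow_zero]; exact Rep.single tone_spec
  | succ n ih => rw [pow_succ]; exact ih.mul rep_P

lemma ball_ex (g : G) : ∃ n, ∀ m, n ≤ m → 1 ≤ m → g ∈ D.P ^ m :=
  ⟨D.dep g, fun _ hm h1 => (D.mem_ball_iff h1 g).2 hm⟩

/-- Determinant condition. -/
def Ok (q : List Tup × Tup) : Prop :=
  (∀ p ∈ q.1, tdet p = 1 ∨ tdet p = -1) ∧ (tdet q.2 = 1 ∨ tdet q.2 = -1)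

def Gen (q : List Tup × Tup) : Prop :=
  tupToMat q.2 ∈ Submonoid.closure {A : M | ∃ p ∈ q.1, tupToMat p = A}

/-- Negative certificate. -/
def Neg (q : List Tup × Tup) (c : ℕ × List Tup) : Prop :=
  tone ∈ c.2 ∧ (∀ p ∈ q.1, p ∈ c.2) ∧ ¬ q.2 ∈ c.2 ∧ q.2 ∈ ball (c.1 + 1) ∧
  (∀ a ∈ c.2, a ∈ ball (c.1 + 1)) ∧
  ∀ a ∈ c.2, ∀ b ∈ c.2, tmul a b ∈ c.2 ∨ ¬ tmul a b ∈ ball (c.1 + 1)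

def tprod (l : List Tup) : Tup := l.foldr tmul tone

lemma tprod_spec (l : List Tup) : tupToMat (tprod l) = (l.map tupToMat).prod := by
  induction l with
  | nil => exact tone_spec
  | cons a l ih =>
    rw [List.map_cons, List.prod_cons, ← ih, ← tmul_spec]; rfl

lemma gen_iff (q : List Tup × Tup) : Gen q ↔ ∃ l : List Tup, (∀ p ∈ l, p ∈ q.1) ∧ tprod l = q.2 := by
  constructor
  · intro h
    obtain ⟨l, hl, he⟩ := Submonoid.exists_list_of_mem_closure h
    choose! f hf using hl
    refine ⟨l.map f, ?_, ?_⟩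
    · intro p hp
      obtain ⟨m, hm, rfl⟩ := List.mem_map.1 hp
      exact (hf m hm).1
    · apply tup_inj
      rw [tprod_spec, ← he, List.map_map]
      congr 1
      conv_rhs => rw [← List.map_id l]
      exact List.map_congr_left fun m hm => (hf m hm).2
  · rintro ⟨l, hl, he⟩
    rw [Gen, ← he, tprod_spec]
    apply Submonoid.list_prod_mem
    intro m hm
    obtain ⟨p, hp, rfl⟩ := List.mem_map.1 hm
    exact Submonoid.subset_closure ⟨p, hl p hp, rfl⟩

lemma neg_sound (q : List Tup × Tup) (c : ℕ × List Tup) (hc : Neg q c) : ¬ Gen q := by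
  obtain ⟨h1, h2, h3, h4, h5, h6⟩ := hc
  rw [gen_iff]
  rintro ⟨l, hl, he⟩
  have hb := rep_ball (c.1 + 1)
  let T : Set G := {g | ∃ t ∈ c.2, tupToMat t = (g : M)}
  have hlift : ∀ l : List Tup, (∀ p ∈ l, p ∈ c.2) →
      ∃ w : List G, (∀ g ∈ w, g ∈ T) ∧ tupToMat (tprod l) = (w.prod : G) := by
    intro l
    induction l with
    | nil => exact fun _ => ⟨[], by simp, tone_spec⟩
    | cons a l ih =>
      intro ha
      obtain ⟨w, hw, e⟩ := ih fun p hp => ha p (List.mem_cons_of_mem _ hp)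
      have hac := ha a List.mem_cons_self
      obtain ⟨g, hg, eg⟩ := (hb a).1 (h5 a hac)
      refine ⟨g :: w, ?_, ?_⟩
      · intro x hx
        rcases List.mem_cons.1 hx with rfl | hx
        · exact ⟨a, hac, eg⟩
        · exact hw x hx
      · rw [List.prod_cons, Units.val_mul, ← e, ← eg, ← tmul_spec]; rfl
  obtain ⟨w, hw, e⟩ := hlift l fun p hp => h2 p (hl p hp)
  have key := D.local_closure (n := c.1 + 1) (by omega) T ⟨tone, h1, tone_spec⟩ ?_ ?_ w hw ?_
  · obtain ⟨t, ht, et⟩ := key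
    rw [← e, he] at et
    rw [tup_inj et] at ht
    exact h3 ht
  · rintro a ⟨t, ht, et⟩
    obtain ⟨g, hg, eg⟩ := (hb t).1 (h5 t ht)
    have : a = g := Units.ext (et.symm.trans eg)
    rwa [this]
  · rintro a ⟨t, ht, et⟩ b ⟨u, hu, eu⟩ hab
    refine ⟨tmul t u, ?_, by rw [tmul_spec, et, eu, Units.val_mul]⟩
    rcases h6 t ht u hu with h | h
    · exact h
    · exact absurd ((hb _).2 ⟨a * b, hab, by rw [tmul_spec, et, eu, Units.val_mul]⟩) h
  · obtain ⟨g, hg, eg⟩ := (hb q.2).1 h4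
    rw [he, eg] at e
    rwa [← Units.ext e]

lemma neg_complete (q : List Tup × Tup) (hq : Ok q) (h : ¬ Gen q) : ∃ c, Neg q c := by
  classical
  have hex : ∀ t : Tup, ∃ n, (tdet t = 1 ∨ tdet t = -1) → ∀ m, n ≤ m → 1 ≤ m → t ∈ ball m := by
    intro t
    by_cases ht : tdet t = 1 ∨ tdet t = -1
    · obtain ⟨g, hg⟩ := unit_of_det ht
      obtain ⟨n, hn⟩ := ball_ex g
      exact ⟨n, fun _ m h1 h2 => (rep_ball m t).2 ⟨g, hn m h1 h2, hg⟩⟩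
    · exact ⟨0, fun h => absurd h ht⟩
  choose N hN using hex
  obtain ⟨K, hK⟩ : ∃ K, ∀ p ∈ q.2 :: q.1, N p ≤ K := by
    refine ⟨((q.2 :: q.1).map N).sum, fun p hp => ?_⟩
    exact List.single_le_sum (fun _ _ => Nat.zero_le _) _ (List.mem_map_of_mem hp)
  have hL : ∀ p ∈ q.1, p ∈ ball (K + 1) := fun p hp =>
    hN p (hq.1 p hp) _ ((hK p (List.mem_cons_of_mem _ hp)).trans (by omega)) (by omega)
  have hM : q.2 ∈ ball (K + 1) :=
    hN q.2 hq.2 _ ((hK q.2 List.mem_cons_self).trans (by omega)) (by omega)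
  let S := Submonoid.closure {A : M | ∃ p ∈ q.1, tupToMat p = A}
  refine ⟨(K, (ball (K + 1)).filter fun t => decide (tupToMat t ∈ S)), ?_⟩
  simp only [Neg, List.mem_filter, decide_eq_true_eq]
  refine ⟨⟨?_, ?_⟩, ?_, ?_, hM, fun a ha => ha.1, ?_⟩
  · exact (rep_ball _ _).2 ⟨1, D.pow_mono (Nat.zero_le _) (by simp), tone_spec⟩
  · rw [tone_spec]; exact S.one_mem
  · exact fun p hp => ⟨hL p hp, Submonoid.subset_closure ⟨p, hp, rfl⟩⟩
  · exact fun h' => h h'.2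
  · intro a ha b hb
    by_cases hab : tmul a b ∈ ball (K + 1)
    · exact Or.inl ⟨hab, by rw [tmul_spec]; exact S.mul_mem ha.2 hb.2⟩
    · exact Or.inr hab

end Topo

/-! ### Computability -/

namespace Cmp

open Encodable

lemma int_enc (z : ℤ) : encode z = if 0 ≤ z then 2 * z.toNat else 2 * (-z - 1).toNat + 1 := by
  rcases z with n | n
  · have : encode (Int.ofNat n) = 2 * n := rfl
    rw [this]; simp
  · have : encode (Int.negSucc n) = 2 * n + 1 := rfl
    rw [this, if_neg (by simp)]
    congr 2
    omega

lemma pr_toNat : Primrec (fun z : ℤ => z.toNat) := by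
  have h : Primrec (fun z : ℤ => if encode z % 2 = 0 then encode z / 2 else 0) :=
    Primrec.ite (Primrec.eq.comp (Primrec.nat_mod.comp Primrec.encode (Primrec.const 2)) (Primrec.const 0))
      (Primrec.nat_div.comp Primrec.encode (Primrec.const 2)) (Primrec.const 0)
  refine h.of_eq fun z => ?_
  rw [int_enc]
  split_ifs <;> omega

lemma pr_negToNat : Primrec (fun z : ℤ => (-z).toNat) := by
  have h : Primrec (fun z : ℤ => if encode z % 2 = 0 then 0 else encode z / 2 + 1) :=
    Primrec.ite (Primrec.eq.comp (Primrec.nat_mod.comp Primrec.encode (Primrec.const 2)) (Primrec.const 0))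
      (Primrec.const 0)
      (Primrec.succ.comp (Primrec.nat_div.comp Primrec.encode (Primrec.const 2)))
  refine h.of_eq fun z => ?_
  rw [int_enc]
  split_ifs <;> omega

lemma pr_sub : Primrec₂ (fun m n : ℕ => (m : ℤ) - n) := by
  rw [← Primrec₂.encode_iff]
  have h : Primrec₂ (fun m n : ℕ => if n ≤ m then 2 * (m - n) else 2 * (n - m - 1) + 1) := by
    refine Primrec.ite (Primrec.nat_le.comp Primrec.snd Primrec.fst)
      (Primrec.nat_mul.comp (Primrec.const 2) (Primrec.nat_sub.comp Primrec.fst Primrec.snd))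
      (Primrec.succ.comp (Primrec.nat_mul.comp (Primrec.const 2)
        (Primrec.nat_sub.comp (Primrec.nat_sub.comp Primrec.snd Primrec.fst) (Primrec.const 1))))
  refine h.of_eq fun m n => ?_
  rw [int_enc]
  split_ifs <;> omega

lemma int_split (z : ℤ) : z = (z.toNat : ℤ) - ((-z).toNat : ℤ) := by omega

lemma pr_add : Primrec₂ (fun x y : ℤ => x + y) := by
  have h : Primrec₂ (fun x y : ℤ =>
      ((x.toNat + y.toNat : ℕ) : ℤ) - (((-x).toNat + (-y).toNat : ℕ) : ℤ)) :=
    pr_sub.comp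
      (Primrec.nat_add.comp (pr_toNat.comp Primrec.fst) (pr_toNat.comp Primrec.snd))
      (Primrec.nat_add.comp (pr_negToNat.comp Primrec.fst) (pr_negToNat.comp Primrec.snd))
  refine h.of_eq fun x y => ?_
  omega

lemma pr_mul : Primrec₂ (fun x y : ℤ => x * y) := by
  have h : Primrec₂ (fun x y : ℤ =>
      ((x.toNat * y.toNat + (-x).toNat * (-y).toNat : ℕ) : ℤ) -
        ((x.toNat * (-y).toNat + (-x).toNat * y.toNat : ℕ) : ℤ)) :=
    pr_sub.comp
      (Primrec.nat_add.comp
        (Primrec.nat_mul.comp (pr_toNat.comp Primrec.fst) (pr_toNat.comp Primrec.snd))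
        (Primrec.nat_mul.comp (pr_negToNat.comp Primrec.fst) (pr_negToNat.comp Primrec.snd)))
      (Primrec.nat_add.comp
        (Primrec.nat_mul.comp (pr_toNat.comp Primrec.fst) (pr_negToNat.comp Primrec.snd))
        (Primrec.nat_mul.comp (pr_negToNat.comp Primrec.fst) (pr_toNat.comp Primrec.snd)))
  refine h.of_eq fun x y => ?_
  push_cast
  conv_rhs => rw [int_split x, int_split y]
  ring

lemma re_of_cert {α β : Type*} [Primcodable α] [Primcodable β] {R : α → β → Prop}
    (hR : PrimrecRel R) : REPred (fun a => ∃ b, R a b) := by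
  classical
  have hR' : Primrec₂ (fun a b => decide (R a b)) := by
    rw [← primrecRel_iff_primrec_decide]; exact hR
  have h1 : Primrec₂ (fun (a : α) (n : ℕ) => ((decode n : Option β).map fun b => decide (R a b)).getD false) := by
    refine Primrec.option_getD.comp ?_ (Primrec.const false)
    exact Primrec.option_map (Primrec.decode.comp Primrec.snd)
      (hR'.comp (Primrec.fst.comp Primrec.fst) Primrec.snd)
  have h2 : Partrec (fun a : α => Nat.rfind (fun n =>
      (Part.some (((decode n : Option β).map fun b => decide (R a b)).getD false)))) :=
    Partrec.rfind h1.to_comp.partrec₂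
  refine h2.dom_re.of_eq fun a => ?_
  refine Nat.rfind_dom.trans ?_
  constructor
  · rintro ⟨n, hn, -⟩
    rcases hd : (decode n : Option β) with _ | b
    · simp [hd] at hn
    · exact ⟨b, by simpa [hd] using hn⟩
  · rintro ⟨b, hb⟩
    exact ⟨encode b, by simp [hb], fun _ => trivial⟩

open Topo

lemma pr_tmul : Primrec₂ tmul := by
  have c1 : Primrec (fun p : Tup × Tup => p.1.1) := Primrec.fst.comp Primrec.fst
  have c2 : Primrec (fun p : Tup × Tup => p.1.2.1) := Primrec.fst.comp (Primrec.snd.comp Primrec.fst)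
  have c3 : Primrec (fun p : Tup × Tup => p.1.2.2.1) :=
    Primrec.fst.comp (Primrec.snd.comp (Primrec.snd.comp Primrec.fst))
  have c4 : Primrec (fun p : Tup × Tup => p.1.2.2.2) :=
    Primrec.snd.comp (Primrec.snd.comp (Primrec.snd.comp Primrec.fst))
  have d1 : Primrec (fun p : Tup × Tup => p.2.1) := Primrec.fst.comp Primrec.snd
  have d2 : Primrec (fun p : Tup × Tup => p.2.2.1) := Primrec.fst.comp (Primrec.snd.comp Primrec.snd)
  have d3 : Primrec (fun p : Tup × Tup => p.2.2.2.1) :=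
    Primrec.fst.comp (Primrec.snd.comp (Primrec.snd.comp Primrec.snd))
  have d4 : Primrec (fun p : Tup × Tup => p.2.2.2.2) :=
    Primrec.snd.comp (Primrec.snd.comp (Primrec.snd.comp Primrec.snd))
  exact Primrec.pair (pr_add.comp (pr_mul.comp c1 d1) (pr_mul.comp c2 d3))
    (Primrec.pair (pr_add.comp (pr_mul.comp c1 d2) (pr_mul.comp c2 d4))
    (Primrec.pair (pr_add.comp (pr_mul.comp c3 d1) (pr_mul.comp c4 d3))
      (pr_add.comp (pr_mul.comp c3 d2) (pr_mul.comp c4 d4))))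

lemma pr_tdet : Primrec tdet := by
  have c1 : Primrec (fun p : Tup => p.1) := Primrec.fst
  have c2 : Primrec (fun p : Tup => p.2.1) := Primrec.fst.comp Primrec.snd
  have c3 : Primrec (fun p : Tup => p.2.2.1) := Primrec.fst.comp (Primrec.snd.comp Primrec.snd)
  have c4 : Primrec (fun p : Tup => p.2.2.2) := Primrec.snd.comp (Primrec.snd.comp Primrec.snd)
  exact pr_add.comp (pr_mul.comp c1 c4) (pr_mul.comp (Primrec.const _) (pr_mul.comp c2 c3))

lemma pr_lmul : Primrec₂ lmul := by
  refine Primrec.list_flatMap Primrec.fst ?_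
  refine Primrec.list_map (Primrec.snd.comp Primrec.fst) ?_
  exact pr_tmul.comp (Primrec.snd.comp Primrec.fst) Primrec.snd

lemma pr_ball : Primrec ball :=
  Primrec.nat_rec₁ _ (pr_lmul.comp Primrec.snd (Primrec.const Pl))

lemma pr_tprod : Primrec tprod :=
  Primrec.list_foldr (h := fun _ p => tmul p.1 p.2) Primrec.id (Primrec.const tone)
    (pr_tmul.comp (Primrec.fst.comp Primrec.snd) (Primrec.snd.comp Primrec.snd))

lemma pr_mem : PrimrecRel (fun (t : Tup) (l : List Tup) => t ∈ l) := by
  have h : PrimrecRel fun (l : List Tup) (t : Tup) => ∃ a ∈ l, a = t :=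
    PrimrecRel.exists_mem_list Primrec.eq
  refine PrimrecPred.of_eq (h.comp Primrec.snd Primrec.fst) ?_
  rintro ⟨t, l⟩
  simp

/-- bounded quantification with parameters -/
lemma pr_ball_list {α β : Type*} [Primcodable α] [Primcodable β] {f : β → List α}
    {R : α → β → Prop} (hf : Primrec f) (hR : PrimrecRel R) :
    PrimrecPred fun b => ∀ a ∈ f b, R a b :=
  (PrimrecRel.forall_mem_list hR).comp hf Primrec.id

lemma pr_det : PrimrecPred fun t : Tup => tdet t = 1 ∨ tdet t = -1 :=
  (Primrec.eq.comp pr_tdet (Primrec.const 1)).or (Primrec.eq.comp pr_tdet (Primrec.const (-1)))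

attribute [local irreducible] Topo.ball Topo.tmul Topo.tprod Topo.tdet

lemma pr_ok : PrimrecPred Ok :=
  PrimrecPred.and
    (pr_ball_list (R := fun t _ => tdet t = 1 ∨ tdet t = -1) Primrec.fst (pr_det.comp Primrec.fst))
    (pr_det.comp Primrec.snd)

lemma pr_neg : PrimrecRel Neg := by
  have c2 : Primrec (fun x : (List Tup × Tup) × (ℕ × List Tup) => x.2.2) :=
    Primrec.snd.comp Primrec.snd
  have bl : Primrec (fun x : (List Tup × Tup) × (ℕ × List Tup) => ball (x.2.1 + 1)) :=
    pr_ball.comp (Primrec.succ.comp (Primrec.fst.comp Primrec.snd))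
  have q1 : Primrec (fun x : (List Tup × Tup) × (ℕ × List Tup) => x.1.1) :=
    Primrec.fst.comp Primrec.fst
  have q2 : Primrec (fun x : (List Tup × Tup) × (ℕ × List Tup) => x.1.2) :=
    Primrec.snd.comp Primrec.fst
  have e1 : PrimrecPred (fun x : (List Tup × Tup) × (ℕ × List Tup) => tone ∈ x.2.2) :=
    pr_mem.comp (Primrec.const tone) c2
  have e2 : PrimrecPred (fun x : (List Tup × Tup) × (ℕ × List Tup) => ∀ p ∈ x.1.1, p ∈ x.2.2) :=
    pr_ball_list q1 (pr_mem.comp Primrec.fst (c2.comp Primrec.snd))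
  have e3 : PrimrecPred (fun x : (List Tup × Tup) × (ℕ × List Tup) => ¬ x.1.2 ∈ x.2.2) :=
    (pr_mem.comp q2 c2).not
  have e4 : PrimrecPred (fun x : (List Tup × Tup) × (ℕ × List Tup) => x.1.2 ∈ ball (x.2.1 + 1)) :=
    pr_mem.comp q2 bl
  have e5 : PrimrecPred (fun x : (List Tup × Tup) × (ℕ × List Tup) =>
      ∀ a ∈ x.2.2, a ∈ ball (x.2.1 + 1)) :=
    pr_ball_list c2 (pr_mem.comp Primrec.fst (bl.comp Primrec.snd))
  have ht : Primrec (fun z : Tup × (Tup × ((List Tup × Tup) × (ℕ × List Tup))) => tmul z.2.1 z.1) :=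
    pr_tmul.comp (Primrec.fst.comp Primrec.snd) Primrec.fst
  have e6 : PrimrecPred (fun z : Tup × (Tup × ((List Tup × Tup) × (ℕ × List Tup))) =>
      tmul z.2.1 z.1 ∈ z.2.2.2.2 ∨ ¬ tmul z.2.1 z.1 ∈ ball (z.2.2.2.1 + 1)) :=
    PrimrecPred.or (pr_mem.comp ht (c2.comp (Primrec.snd.comp Primrec.snd)))
      (pr_mem.comp ht (bl.comp (Primrec.snd.comp Primrec.snd))).not
  have e7 : PrimrecPred (fun y : Tup × ((List Tup × Tup) × (ℕ × List Tup)) =>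
      ∀ b ∈ y.2.2.2, tmul y.1 b ∈ y.2.2.2 ∨ ¬ tmul y.1 b ∈ ball (y.2.2.1 + 1)) :=
    pr_ball_list (c2.comp Primrec.snd) e6.primrecRel
  have e8 : PrimrecPred (fun x : (List Tup × Tup) × (ℕ × List Tup) =>
      ∀ a ∈ x.2.2, ∀ b ∈ x.2.2, tmul a b ∈ x.2.2 ∨ ¬ tmul a b ∈ ball (x.2.1 + 1)) :=
    pr_ball_list c2 e7.primrecRel
  exact (e1.and (e2.and (e3.and (e4.and (e5.and e8))))).primrecRel

lemma main : ComputablePred (fun q => Ok q ∧ Gen q) := by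
  rw [ComputablePred.computable_iff_re_compl_re']
  constructor
  · have h : PrimrecRel fun (q : List Tup × Tup) (l : List Tup) =>
        Ok q ∧ (∀ p ∈ l, p ∈ q.1) ∧ tprod l = q.2 := by
      have f1 : PrimrecPred (fun x : (List Tup × Tup) × List Tup => Ok x.1) := pr_ok.comp Primrec.fst
      have f0 : Primrec (fun y : Tup × ((List Tup × Tup) × List Tup) => y.2.1.1) :=
        Primrec.fst.comp (Primrec.fst.comp Primrec.snd)
      have f2' : PrimrecPred (fun y : Tup × ((List Tup × Tup) × List Tup) => y.1 ∈ y.2.1.1) :=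
        pr_mem.comp Primrec.fst f0
      have f2 : PrimrecPred (fun x : (List Tup × Tup) × List Tup => ∀ p ∈ x.2, p ∈ x.1.1) :=
        pr_ball_list Primrec.snd f2'.primrecRel
      have f3 : PrimrecPred (fun x : (List Tup × Tup) × List Tup => Topo.tprod x.2 = x.1.2) :=
        Primrec.eq.comp (pr_tprod.comp Primrec.snd) (Primrec.snd.comp Primrec.fst)
      exact (f1.and (f2.and f3)).primrecRel
    refine (re_of_cert h).of_eq fun q => ?_
    rw [gen_iff]
    constructor
    · rintro ⟨l, h1, h2⟩; exact ⟨h1, l, h2⟩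
    · rintro ⟨h1, l, h2⟩; exact ⟨l, h1, h2⟩
  · have h : PrimrecRel fun (q : List Tup × Tup) (c : ℕ × List Tup) => ¬ Ok q ∨ Neg q c := by
      have f1 : PrimrecPred (fun x : (List Tup × Tup) × (ℕ × List Tup) => ¬ Ok x.1) :=
        (pr_ok.comp Primrec.fst).not
      have f2 : PrimrecPred (fun x : (List Tup × Tup) × (ℕ × List Tup) => Neg x.1 x.2) :=
        pr_neg.comp Primrec.fst Primrec.snd
      exact (f1.or f2).primrecRel
    refine (re_of_cert h).of_eq fun q => ?_
    constructor
    · rintro ⟨c, h | h⟩ ⟨h1, h2⟩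
      · exact h h1
      · exact neg_sound q c h h2
    · intro h
      by_cases hq : Ok q
      · obtain ⟨c, hc⟩ := neg_complete q hq fun hg => h ⟨hq, hg⟩
        exact ⟨c, Or.inr hc⟩
      · exact ⟨(0, []), Or.inl hq⟩

end Cmp

/-- The membership problem for GL(2,ℤ) is decidable. -/
theorem membership_problem_GL_decidable :
    ComputablePred (fun q : List (ℤ × ℤ × ℤ × ℤ) × (ℤ × ℤ × ℤ × ℤ) =>
      (∀ p ∈ q.1, (tupToMat p).det = 1 ∨ (tupToMat p).det = -1) ∧
      ((tupToMat q.2).det = 1 ∨ (tupToMat q.2).det = -1) ∧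
      tupToMat q.2 ∈ Submonoid.closure {A : M2 | ∃ p ∈ q.1, tupToMat p = A}) := by
  refine Cmp.main.of_eq fun q => ?_
  simp only [Topo.tdet_spec, Topo.Ok, Topo.Gen, and_assoc]
end
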